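/- arXiv:2404.07441 — 2 statements merged into one kernel-verified Lean document; each statement's English description precedes it below -/
import Mathlib

section
/- Let q be a prime power. For all ξ > 0 the following holds for all sufficiently large ℓ. Let ℓ' ≥ (ξ/3)ℓ be an integer, set δ₂ = ξ/100, and let V be a finite-dimensional F_q-vector space with dim(V) ≥ ℓ'². Let 𝓛 ⊆ Grass(V, ℓ') have measure μ(𝓛) = η ≥ q^{−2ℓ}, and set Z = {z ∈ V : |μ_{span(z)}(𝓛) − η| ≤ η/10}. If 𝓛 is (1, q^{δ₂ℓ/100}·η)-pseudo-random, then |Z| ≥ (1 − q^{−ℓ'/2})·|V|, where |V| and |Z| count vectors. -/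
open Module

/-- The fraction of `ℓ`-dimensional subspaces of `V` lying in `𝓛`. -/
noncomputable def grassFrac (F V : Type*) [Field F] [AddCommGroup V] [Module F V]
    (ℓ : ℕ) (𝓛 : Set (Submodule F V)) : ℝ :=
  (Nat.card {L : Submodule F V // finrank F ↥L = ℓ ∧ L ∈ 𝓛} : ℝ) /
    (Nat.card {L : Submodule F V // finrank F ↥L = ℓ} : ℝ)

/-- The fraction of `ℓ`-dimensional subspaces `L` of `V` with `Q ⊆ L ⊆ W` lying in `𝓛`. -/
noncomputable def zoomFrac (F V : Type*) [Field F] [AddCommGroup V] [Module F V]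
    (ℓ : ℕ) (Q W : Submodule F V) (𝓛 : Set (Submodule F V)) : ℝ :=
  (Nat.card {L : Submodule F V // finrank F ↥L = ℓ ∧ Q ≤ L ∧ L ≤ W ∧ L ∈ 𝓛} : ℝ) /
    (Nat.card {L : Submodule F V // finrank F ↥L = ℓ ∧ Q ≤ L ∧ L ≤ W} : ℝ)

/-- `𝓛` is `(r, ε)`-pseudo-random. -/
def PseudoRandom (F V : Type*) [Field F] [AddCommGroup V] [Module F V]
    (ℓ r : ℕ) (ε : ℝ) (𝓛 : Set (Submodule F V)) : Prop :=
  ∀ Q W : Submodule F V, Q ≤ W →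
    finrank F ↥Q + (finrank F V - finrank F ↥W) = r →
    zoomFrac F V ℓ Q W 𝓛 ≤ ε

open scoped BigOperators

/-- A recursive moment bound for a sum of nonnegative random variables on a finite uniform
probability space. -/
lemma expect_sum_pow_le {Ω X : Type*} [Fintype Ω] [Nonempty Ω] [Fintype X]
    (Z : X → Ω → ℝ) (c : ℕ → ℝ) (hc : ∀ i, 0 ≤ c i)
    (h : ∀ p (x : Fin p → X),
      𝔼 ω, (∏ i, Z (x i) ω) * ∑ y, Z y ω ≤ c p * 𝔼 ω, ∏ i, Z (x i) ω) (p : ℕ) :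
    𝔼 ω, (∑ y, Z y ω) ^ p ≤ ∏ i ∈ Finset.range p, c i := by
  classical
  have key : ∀ p ω, (∑ y, Z y ω) ^ p = ∑ x : Fin p → X, ∏ i, Z (x i) ω := by
    intro p ω
    rw [Finset.sum_pow', Fintype.piFinset_univ]
  induction p with
  | zero => simp
  | succ p ih =>
    rw [Finset.prod_range_succ, mul_comm]
    calc 𝔼 ω, (∑ y, Z y ω) ^ (p + 1)
        = ∑ x : Fin p → X, 𝔼 ω, (∏ i, Z (x i) ω) * ∑ y, Z y ω := by
          rw [← Finset.expect_sum_comm]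
          refine Finset.expect_congr rfl fun ω _ => ?_
          rw [pow_succ, key, Finset.sum_mul]
      _ ≤ ∑ x : Fin p → X, c p * 𝔼 ω, ∏ i, Z (x i) ω := Finset.sum_le_sum fun x _ => h p x
      _ = c p * 𝔼 ω, (∑ y, Z y ω) ^ p := by
          rw [← Finset.mul_sum, ← Finset.expect_sum_comm]
          simp only [key]
      _ ≤ _ := mul_le_mul_of_nonneg_left ih (hc p)

/-- Moments of a weighted sum of values of a bounded function along a random linear map. -/
lemma expect_linearMap_sum_pow_le {F E Y Ω : Type*} [Field F] [Fintype F]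
    [AddCommGroup E] [Module F E] [Fintype E] [AddCommGroup Y] [Module F Y] [Fintype Y]
    [AddCommGroup Ω] [Fintype Ω] (T : Ω →+ (E →ₗ[F] Y))
    (hT : ∀ (U : Submodule F E) (x : E), x ∉ U → ∀ y : Y, ∃ ω, (∀ u ∈ U, T ω u = 0) ∧ T ω x = y)
    (w : E → ℝ) (W : ℝ) (hw : ∀ x, 0 ≤ w x) (hW : ∀ x, w x ≤ W)
    (h : Y → ℝ) (s : ℝ) (hh : ∀ y, 0 ≤ h y) (hs : ∀ y, h y ≤ s) (v : Y) (p : ℕ) :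
    𝔼 ω, (∑ x, w x * h (v + T ω x)) ^ p ≤
      ((∑ x, w x) * (𝔼 y, h y) + (Fintype.card F : ℝ) ^ p * (W * s)) ^ p := by
  classical
  have hW0 : 0 ≤ W := (hw 0).trans (hW 0)
  have hs0 : 0 ≤ s := (hh 0).trans (hs 0)
  have hE0 : 0 ≤ 𝔼 y, h y := Finset.expect_nonneg fun y _ => hh y
  have hS0 : 0 ≤ ∑ x, w x := Finset.sum_nonneg fun x _ => hw x
  have hq : (1 : ℝ) ≤ Fintype.card F := by exact_mod_cast Fintype.card_pos
  have indep : ∀ (U : Submodule F E) (x : E), x ∉ U → ∀ Φ : Ω → ℝ,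
      (∀ ω ω', (∀ u ∈ U, T ω' u = 0) → Φ (ω + ω') = Φ ω) →
      𝔼 ω, Φ ω * h (v + T ω x) = (𝔼 ω, Φ ω) * 𝔼 y, h y := by
    intro U x hx Φ hΦ
    choose sh hsh using hT U x hx
    have e1 : ∀ y : Y, 𝔼 ω, Φ ω * h (v + T ω x) = 𝔼 ω, Φ ω * h (v + T ω x + y) := by
      intro y
      rw [← Fintype.expect_equiv (Equiv.addRight (sh y))
        (fun ω => Φ ω * h (v + T ω x + y)) (fun ω => Φ ω * h (v + T ω x))]
      intro ω
      simp only [Equiv.coe_addRight]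
      rw [hΦ ω (sh y) (hsh y).1, map_add, LinearMap.add_apply, (hsh y).2, add_assoc]
    calc 𝔼 ω, Φ ω * h (v + T ω x)
        = 𝔼 _y : Y, 𝔼 ω, Φ ω * h (v + T ω x) := (Fintype.expect_const _).symm
      _ = 𝔼 y, 𝔼 ω, Φ ω * h (v + T ω x + y) := Finset.expect_congr rfl fun y _ => e1 y
      _ = 𝔼 ω, Φ ω * 𝔼 y, h y := by
          rw [Finset.expect_comm]
          refine Finset.expect_congr rfl fun ω _ => ?_
          rw [← Finset.mul_expect]
          congr 1
          exact Fintype.expect_equiv (Equiv.addLeft (v + T ω x)) _ _ fun y => rfl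
      _ = _ := by rw [Finset.expect_mul]
  have step := expect_sum_pow_le (fun x ω => w x * h (v + T ω x))
    (fun i => (∑ x, w x) * (𝔼 y, h y) + (Fintype.card F : ℝ) ^ i * (W * s))
    (fun i => by positivity) ?_ p
  · refine step.trans ?_
    refine (Finset.prod_le_prod (fun i _ => by positivity) fun i hi => ?_).trans_eq
      (by rw [Finset.prod_const, Finset.card_range])
    have := pow_le_pow_right₀ hq (Finset.mem_range.1 hi).le
    gcongr
  · intro p x
    set Φ : Ω → ℝ := fun ω => ∏ i, w (x i) * h (v + T ω (x i)) with hΦd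
    have hΦ0 : ∀ ω, 0 ≤ Φ ω := fun ω => Finset.prod_nonneg fun i _ => mul_nonneg (hw _) (hh _)
    set U : Submodule F E := Submodule.span F (Set.range x) with hU
    have hinv : ∀ ω ω', (∀ u ∈ U, T ω' u = 0) → Φ (ω + ω') = Φ ω := by
      intro ω ω' hu
      simp only [hΦd]
      refine Finset.prod_congr rfl fun i _ => ?_
      rw [map_add, LinearMap.add_apply, hu (x i) (Submodule.subset_span ⟨i, rfl⟩), add_zero]
    have hcard : ((Finset.univ.filter (· ∈ U)).card : ℝ) ≤ (Fintype.card F : ℝ) ^ p := by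
      have h1 : (Finset.univ.filter (· ∈ U)).card = Fintype.card F ^ finrank F U := by
        rw [← Module.card_eq_pow_finrank (K := F) (V := U)]
        exact (Fintype.card_subtype _).symm
      have h2 : finrank F U ≤ p := by
        exact (finrank_range_le_card (R := F) x).trans_eq (Fintype.card_fin p)
      rw [h1]
      push_cast
      exact pow_le_pow_right₀ hq h2
    change 𝔼 ω, Φ ω * ∑ y, w y * h (v + T ω y) ≤ _ * 𝔼 ω, Φ ω
    calc 𝔼 ω, Φ ω * ∑ y, w y * h (v + T ω y)
        = ∑ y, 𝔼 ω, Φ ω * (w y * h (v + T ω y)) := by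
          rw [← Finset.expect_sum_comm]
          simp only [Finset.mul_sum]
      _ = ∑ y with y ∈ U, 𝔼 ω, Φ ω * (w y * h (v + T ω y)) +
            ∑ y with y ∉ U, 𝔼 ω, Φ ω * (w y * h (v + T ω y)) :=
          (Finset.sum_filter_add_sum_filter_not _ _ _).symm
      _ ≤ ∑ y with y ∈ U, (𝔼 ω, Φ ω) * (W * s) +
            ∑ y with y ∉ U, w y * ((𝔼 ω, Φ ω) * 𝔼 y, h y) := by
          refine add_le_add (Finset.sum_le_sum fun y _ => ?_) (Finset.sum_le_sum fun y hy => ?_)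
          · rw [Finset.expect_mul]
            refine Finset.expect_le_expect fun ω _ => ?_
            exact mul_le_mul_of_nonneg_left
              (mul_le_mul (hW y) (hs _) (hh _) hW0) (hΦ0 ω)
          · rw [← indep U y (Finset.mem_filter.1 hy).2 Φ hinv, Finset.mul_expect]
            exact le_of_eq (Finset.expect_congr rfl fun ω _ => by ring)
      _ ≤ (Fintype.card F : ℝ) ^ p * ((𝔼 ω, Φ ω) * (W * s)) +
            (∑ y, w y) * ((𝔼 ω, Φ ω) * 𝔼 y, h y) := by
          have hP : 0 ≤ 𝔼 ω, Φ ω := Finset.expect_nonneg fun ω _ => hΦ0 ω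
          refine add_le_add ?_ ?_
          · rw [Finset.sum_const, nsmul_eq_mul]
            exact mul_le_mul_of_nonneg_right hcard (by positivity)
          · rw [← Finset.sum_mul]
            refine mul_le_mul_of_nonneg_right ?_ (by positivity)
            exact Finset.sum_le_sum_of_subset_of_nonneg (Finset.filter_subset _ _)
              fun y _ _ => hw y
      _ = _ := by ring

section Fourier

variable {F : Type*} [Field F] (χ : AddChar F ℂ)

lemma expect_addChar_linearMap {E : Type*} [AddCommGroup E] [Module F E] [Fintype E]
    (hχ : χ ≠ 0) (β : E →ₗ[F] F) [Decidable (β = 0)] :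
    𝔼 x, χ (β x) = if β = 0 then 1 else 0 := by
  classical
  split_ifs with hβ
  · simp [hβ]
  · have hne : χ.compAddMonoidHom β.toAddMonoidHom ≠ 0 := by
      intro h0
      apply hχ
      ext c
      obtain ⟨x, rfl⟩ := LinearMap.surjective hβ c
      simpa using DFunLike.congr_fun h0 x
    have := AddChar.sum_eq_zero_iff_ne_zero.2 hne
    rw [Fintype.expect_eq_sum_div_card]
    simp only [AddChar.compAddMonoidHom_apply, LinearMap.toAddMonoidHom_coe] at this
    simp [this]

variable {V : Type*} [AddCommGroup V] [Module F V] [Fintype V]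

/-- The Fourier coefficient of `g` at the linear functional `α`. -/
noncomputable def dualFourier (g : V → ℝ) (α : Dual F V) : ℂ := 𝔼 v, (g v : ℂ) * χ (α v)

lemma dualFourier_average {E : Type*} [AddCommGroup E] [Module F E] [Fintype E]
    (hχ : χ ≠ 0) (g : V → ℝ) (T : E →ₗ[F] V) (α : Dual F V) [Decidable (α ∘ₗ T = 0)] :
    dualFourier χ (fun v => 𝔼 x, g (v + T x)) α =
      if α ∘ₗ T = 0 then dualFourier χ g α else 0 := by
  classical
  have h1 : dualFourier χ (fun v => 𝔼 x, g (v + T x)) α =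
      𝔼 x, χ ((-(α ∘ₗ T)) x) * dualFourier χ g α := by
    have hc : ∀ v, ((𝔼 x, g (v + T x) : ℝ) : ℂ) = 𝔼 x, (g (v + T x) : ℂ) := by
      intro v
      rw [Fintype.expect_eq_sum_div_card, Fintype.expect_eq_sum_div_card]
      push_cast
      rfl
    simp only [dualFourier, hc, Finset.expect_mul]
    rw [Finset.expect_comm]
    refine Finset.expect_congr rfl fun x _ => ?_
    rw [Finset.mul_expect]
    refine Fintype.expect_equiv (Equiv.addRight (T x)) _ _ fun v => ?_
    simp only [Equiv.coe_addRight, LinearMap.neg_apply, LinearMap.comp_apply, map_add]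
    rw [mul_left_comm, ← AddChar.map_add_eq_mul]
    congr 2
    abel_nf
  rw [h1, ← Finset.expect_mul, expect_addChar_linearMap χ hχ]
  simp only [neg_eq_zero]
  split_ifs <;> simp

variable [Fintype F]

lemma sum_dual_addChar [Fintype (Dual F V)] [DecidableEq V] (hχ : χ ≠ 0) (v : V) :
    ∑ α : Dual F V, χ (α v) = if v = 0 then (Fintype.card V : ℂ) else 0 := by
  classical
  have h := expect_addChar_linearMap χ hχ (Dual.eval F V v)
  have hc : (Fintype.card (Dual F V) : ℂ) = Fintype.card V := by
    rw [Module.card_eq_pow_finrank (K := F) (V := Dual F V),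
      Module.card_eq_pow_finrank (K := F) (V := V), Subspace.dual_finrank_eq]
  have hz : Dual.eval F V v = 0 ↔ v = 0 := by
    rw [← Module.forall_dual_apply_eq_zero_iff F v]
    exact ⟨fun h φ => DFunLike.congr_fun h φ, fun h => LinearMap.ext h⟩
  simp only [hz, Dual.eval_apply] at h
  rw [← Fintype.card_mul_expect, h, hc]
  simp

lemma sum_normSq_dualFourier [Fintype (Dual F V)] (hχ : χ ≠ 0) (g : V → ℝ) :
    ∑ α : Dual F V, Complex.normSq (dualFourier χ g α) = 𝔼 v, g v ^ 2 := by
  classical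
  have hN : (Fintype.card V : ℂ) ≠ 0 := by exact_mod_cast Fintype.card_ne_zero
  have h1 : ∀ α : Dual F V, (Complex.normSq (dualFourier χ g α) : ℂ) =
      𝔼 v, 𝔼 u, (g v * g u : ℂ) * χ (α (v - u)) := by
    intro α
    have hconj : (starRingEnd ℂ) (dualFourier χ g α) = 𝔼 u, (g u : ℂ) * χ (-(α u)) := by
      rw [dualFourier, Fintype.expect_eq_sum_div_card, Fintype.expect_eq_sum_div_card, map_div₀,
        map_sum]
      simp [AddChar.map_neg_eq_conj]
    rw [← Complex.mul_conj, hconj, dualFourier, Fintype.expect_mul_expect]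
    refine Finset.expect_congr rfl fun v _ => Finset.expect_congr rfl fun u _ => ?_
    rw [map_sub, sub_eq_add_neg, AddChar.map_add_eq_mul]
    ring
  have : ((∑ α : Dual F V, Complex.normSq (dualFourier χ g α) : ℝ) : ℂ) =
      ((𝔼 v, g v ^ 2 : ℝ) : ℂ) := by
    rw [Complex.ofReal_sum]
    simp only [h1]
    rw [← Finset.expect_sum_comm]
    have h2 : ∀ v, ∑ α : Dual F V, 𝔼 u, (g v * g u : ℂ) * χ (α (v - u)) = (g v : ℂ) ^ 2 := by
      intro v
      rw [← Finset.expect_sum_comm]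
      simp only [← Finset.mul_sum, sum_dual_addChar χ hχ, sub_eq_zero]
      rw [Fintype.expect_eq_sum_div_card]
      simp only [mul_ite, mul_zero, Finset.sum_ite_eq, Finset.mem_univ, if_true]
      field_simp
    simp only [h2]
    rw [Fintype.expect_eq_sum_div_card, Fintype.expect_eq_sum_div_card]
    push_cast
    rfl
  exact_mod_cast this

lemma expect_average_sq {E : Type*} [AddCommGroup E] [Module F E] [Fintype E]
    [Fintype (Dual F V)] (hχ : χ ≠ 0) (g : V → ℝ) (T : E →ₗ[F] V)
    [DecidablePred fun α : Dual F V => α ∘ₗ T = 0] :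
    𝔼 v, (𝔼 x, g (v + T x)) ^ 2 =
      ∑ α : Dual F V, if α ∘ₗ T = 0 then Complex.normSq (dualFourier χ g α) else 0 := by
  rw [← sum_normSq_dualFourier χ hχ]
  refine Finset.sum_congr rfl fun α _ => ?_
  rw [dualFourier_average χ hχ]
  split_ifs <;> simp

end Fourier

section Shift

variable {F : Type*} [Field F]

lemma exists_dual_eq_one_of_notMem {E : Type*} [AddCommGroup E] [Module F E]
    {U : Submodule F E} {x : E} (hx : x ∉ U) :
    ∃ β : Dual F E, (∀ u ∈ U, β u = 0) ∧ β x = 1 := by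
  obtain ⟨f, hf, hU⟩ := Submodule.exists_dual_map_eq_bot_of_notMem hx inferInstance
  refine ⟨(f x)⁻¹ • f, fun u hu => ?_, by simp [hf]⟩
  have : f u ∈ U.map f := ⟨u, hu, rfl⟩
  rw [hU, Submodule.mem_bot] at this
  simp [this]

variable {ι V : Type*} [AddCommGroup V] [Module F V]

/-- Evaluation of linear functionals on a tuple, additively in the tuple. -/
def tupleDualMap : (ι → V) →+ (Dual F V →ₗ[F] (ι → F)) where
  toFun M := LinearMap.pi fun i => LinearMap.applyₗ (M i)
  map_zero' := by ext; simp
  map_add' M M' := by ext; simp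

lemma tupleDualMap_apply (M : ι → V) (α : Dual F V) (i : ι) : tupleDualMap M α i = α (M i) := rfl

lemma exists_tupleDualMap_eq [FiniteDimensional F V] (U : Submodule F (Dual F V)) (α : Dual F V)
    (hα : α ∉ U) (y : ι → F) :
    ∃ M : ι → V, (∀ β ∈ U, tupleDualMap M β = 0) ∧ tupleDualMap M α = y := by
  obtain ⟨φ, hU, hφ⟩ := exists_dual_eq_one_of_notMem hα
  obtain ⟨v, rfl⟩ := (Module.evalEquiv F V).surjective φ
  simp only [Module.evalEquiv_apply, Dual.eval_apply] at hU hφ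
  refine ⟨fun i => y i • v, fun β hβ => ?_, ?_⟩
  · ext i
    simp [tupleDualMap_apply, hU β hβ]
  · ext i
    simp [tupleDualMap_apply, hφ]

variable [Fintype ι]

/-- The linear map with prescribed values on the standard basis, additively in the values. -/
noncomputable def tupleMap : (ι → V) →+ ((ι → F) →ₗ[F] V) where
  toFun M := Fintype.linearCombination F M
  map_zero' := by ext; simp [Fintype.linearCombination_apply]
  map_add' M M' := by
    ext; simp [Fintype.linearCombination_apply, Finset.sum_add_distrib, smul_add]

lemma tupleMap_apply (M : ι → V) (x : ι → F) : tupleMap M x = ∑ i, x i • M i :=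
  Fintype.linearCombination_apply _ _ _

lemma comp_tupleMap_eq_zero_iff (M : ι → V) (α : Dual F V) :
    α ∘ₗ tupleMap M = 0 ↔ tupleDualMap M α = 0 := by
  classical
  constructor
  · intro h
    ext i
    have := DFunLike.congr_fun h (Pi.single i 1)
    simpa [tupleMap_apply, tupleDualMap_apply, Pi.single_apply] using this
  · intro h
    ext i
    have := congr_fun h i
    simpa [tupleMap_apply, tupleDualMap_apply, Pi.single_apply] using this

lemma exists_tupleMap_eq (U : Submodule F (ι → F)) (x : ι → F) (hx : x ∉ U) (y : V) :
    ∃ M : ι → V, (∀ u ∈ U, tupleMap M u = 0) ∧ tupleMap M x = y := by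
  classical
  obtain ⟨β, hU, hβ⟩ := exists_dual_eq_one_of_notMem hx
  have key : ∀ u, tupleMap (fun i => β (Pi.single i 1) • y) u = β u • y := by
    intro u
    rw [tupleMap_apply, LinearMap.pi_apply_eq_sum_univ β u, Finset.sum_smul]
    refine Finset.sum_congr rfl fun i _ => ?_
    rw [smul_smul, smul_eq_mul]
    congr 3
    ext j
    simp [Pi.single_apply, eq_comm]
  exact ⟨_, fun u hu => by rw [key, hU u hu, zero_smul], by rw [key, hβ, one_smul]⟩

end Shift

section Moments

variable {F : Type*} [Field F] [Fintype F] {V : Type*} [AddCommGroup V] [Module F V] [Fintype V]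
  {ι : Type*} [Fintype ι] [DecidableEq ι]

lemma expect_average_pow_le (h : V → ℝ) (s : ℝ) (hh : ∀ y, 0 ≤ h y) (hs : ∀ y, h y ≤ s)
    (v : V) (p : ℕ) :
    𝔼 M : ι → V, (𝔼 x : ι → F, h (v + tupleMap M x)) ^ p ≤
      ((𝔼 y, h y) + (Fintype.card F : ℝ) ^ p * (s / (Fintype.card F : ℝ) ^ Fintype.card ι)) ^ p := by
  have hN : (Fintype.card (ι → F) : ℝ) = (Fintype.card F : ℝ) ^ Fintype.card ι := by
    simp
  have hq : (0 : ℝ) < Fintype.card F := by exact_mod_cast Fintype.card_pos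
  have := expect_linearMap_sum_pow_le (F := F) (tupleMap (F := F) (ι := ι) (V := V))
    exists_tupleMap_eq (fun _ => 1 / (Fintype.card F : ℝ) ^ Fintype.card ι) _
    (fun _ => by positivity) (fun _ => le_rfl) h s hh hs v p
  convert this using 4
  · rw [Fintype.expect_eq_sum_div_card, hN, ← Finset.mul_sum]
    ring
  · rw [Finset.sum_const, Finset.card_univ, nsmul_eq_mul, hN]
    field_simp
  · ring

lemma expect_norm_average_pow_le (χ : AddChar F ℂ) (hχ : χ ≠ 0) (g : V → ℝ) (w : ℝ)
    (hw : ∀ α : Dual F V, Complex.normSq (dualFourier χ g α) ≤ w) (p : ℕ) :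
    𝔼 M : ι → V, (𝔼 v, (𝔼 x : ι → F, g (v + tupleMap M x)) ^ 2) ^ p ≤
      ((𝔼 v, g v ^ 2) / (Fintype.card F : ℝ) ^ Fintype.card ι +
        (Fintype.card F : ℝ) ^ p * w) ^ p := by
  classical
  have : Finite (Dual F V) := Module.finite_of_finite F
  have : Fintype (Dual F V) := Fintype.ofFinite _
  have := expect_linearMap_sum_pow_le (F := F) (tupleDualMap (F := F) (ι := ι) (V := V))
    exists_tupleDualMap_eq (fun α => Complex.normSq (dualFourier χ g α)) w
    (fun _ => Complex.normSq_nonneg _) hw (fun y => if y = 0 then 1 else 0) 1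
    (fun y => by positivity) (fun y => by split_ifs <;> norm_num) 0 p
  simp only [zero_add, mul_ite, mul_one, mul_zero] at this
  simp only [expect_average_sq χ hχ, comp_tupleMap_eq_zero_iff]
  refine this.trans_eq ?_
  rw [sum_normSq_dualFourier χ hχ, Fintype.expect_eq_sum_div_card (fun y : ι → F => _)]
  simp [div_eq_mul_inv]

end Moments

lemma le_add_mul_div_pow {t y : ℝ} (ht : 0 < t) (hy : 0 ≤ y) {n : ℕ} (hn : n ≠ 0) :
    y ≤ t + t * (y / t) ^ n := by
  rcases le_total y t with h | h
  · have : 0 ≤ t * (y / t) ^ n := by positivity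
    linarith
  · have h1 : 1 ≤ y / t := (one_le_div ht).2 h
    have h2 : y / t ≤ (y / t) ^ n := le_self_pow₀ h1 hn
    have h3 : t * (y / t) ≤ t * (y / t) ^ n := mul_le_mul_of_nonneg_left h2 ht.le
    rw [mul_div_cancel₀ _ ht.ne'] at h3
    linarith

lemma le_min_add_mul_div_pow {s y : ℝ} (hs : 0 < s) (hy : 0 ≤ y) {n : ℕ} (hn : n ≠ 0) :
    y ≤ min y s + s * (y / s) ^ n := by
  rcases le_total y s with h | h
  · have : 0 ≤ s * (y / s) ^ n := by positivity
    rw [min_eq_left h]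
    linarith
  · rw [min_eq_right h]
    exact le_add_mul_div_pow hs hy hn

lemma abs_expect_le {X : Type*} [Fintype X] (f : X → ℝ) : |𝔼 x, f x| ≤ 𝔼 x, |f x| := by
  rw [Fintype.expect_eq_sum_div_card, Fintype.expect_eq_sum_div_card, abs_div, Nat.abs_cast]
  gcongr
  exact Finset.abs_sum_le_sum_abs _ _

lemma expect_abs_le_sqrt {X : Type*} [Fintype X] [Nonempty X] (f : X → ℝ) :
    𝔼 x, |f x| ≤ √(𝔼 x, f x ^ 2) := by
  apply Real.le_sqrt_of_sq_le
  have hc : (0 : ℝ) < Fintype.card X := by exact_mod_cast Fintype.card_pos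
  rw [Fintype.expect_eq_sum_div_card, Fintype.expect_eq_sum_div_card, div_pow,
    div_le_div_iff₀ (by positivity) hc]
  have := sq_sum_le_card_mul_sum_sq (s := Finset.univ) (f := fun x => |f x|)
  simp only [sq_abs, Finset.card_univ] at this
  nlinarith

section Core

variable {F : Type*} [Field F] [Fintype F] {V : Type*} [AddCommGroup V] [Module F V] [Fintype V]
  {ι κ : Type*} [Fintype ι] [DecidableEq ι] [Fintype κ] [DecidableEq κ]

/-- A function with small Fourier coefficients has small average on a random subspace, up to
events of very small probability. -/
lemma expect_mul_abs_average_le (χ : AddChar F ℂ) (hχ : χ ≠ 0) (g : V → ℝ) (hg : ∀ v, |g v| ≤ 1)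
    (w S : ℝ) (hS : 0 ≤ S) (hgS : 𝔼 v, g v ^ 2 = S ^ 2)
    (hw : ∀ α : Dual F V, Complex.normSq (dualFourier χ g α) ≤ w)
    (I : (ι → V) → (κ → V) → ℝ) (hI0 : ∀ M M', 0 ≤ I M M') (hI1 : ∀ M M', I M M' ≤ 1)
    (s t : ℝ) (hs : 0 < s) (ht : 0 < t) (p : ℕ) (hp : p ≠ 0) :
    𝔼 M, 𝔼 M', I M M' * |𝔼 u : κ → F, 𝔼 x : ι → F, g (tupleMap M' u + tupleMap M x)| ≤
      t * (𝔼 M, 𝔼 M', I M M') +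
      t * (2 ^ (2 * p) * ((S ^ 2 / (Fintype.card F : ℝ) ^ Fintype.card ι +
        (Fintype.card F : ℝ) ^ p * w) ^ p + ((Fintype.card F : ℝ) ^ (2 * p) *
          (s / (Fintype.card F : ℝ) ^ Fintype.card κ)) ^ (2 * p)) / t ^ (2 * p)) +
      s * ((S + (Fintype.card F : ℝ) ^ (2 * p) *
        (1 / (Fintype.card F : ℝ) ^ Fintype.card ι)) ^ (2 * p) / s ^ (2 * p)) := by
  have h2p : 2 * p ≠ 0 := by omega
  set q : ℝ := (Fintype.card F : ℝ) with hq
  have hq0 : 0 < q := by rw [hq]; exact_mod_cast Fintype.card_pos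
  let A : (ι → V) → V → ℝ := fun M v => 𝔼 x : ι → F, g (v + tupleMap M x)
  let Y : (ι → V) → (κ → V) → ℝ := fun M M' => 𝔼 u : κ → F, min |A M (tupleMap M' u)| s
  let R : (ι → V) → (κ → V) → ℝ := fun M M' =>
    𝔼 u : κ → F, s * (|A M (tupleMap M' u)| / s) ^ (2 * p)
  have hY0 : ∀ M M', 0 ≤ Y M M' := fun M M' =>
    Finset.expect_nonneg fun u _ => le_min (abs_nonneg _) hs.le
  have hR0 : ∀ M M', 0 ≤ R M M' := fun M M' =>
    Finset.expect_nonneg fun u _ => by positivity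
  have hpt : ∀ M M', I M M' * |𝔼 u : κ → F, A M (tupleMap M' u)| ≤
      t * I M M' + t * (Y M M' / t) ^ (2 * p) + R M M' := by
    intro M M'
    have h1 : |𝔼 u : κ → F, A M (tupleMap M' u)| ≤ Y M M' + R M M' := by
      refine (abs_expect_le _).trans ?_
      rw [← Finset.expect_add_distrib]
      exact Finset.expect_le_expect fun u _ =>
        le_min_add_mul_div_pow hs (abs_nonneg _) h2p
    have h2 := le_add_mul_div_pow ht (hY0 M M') h2p
    have h3 : 0 ≤ t * (Y M M' / t) ^ (2 * p) := by
      have := hY0 M M'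
      positivity
    have := hI0 M M'
    calc I M M' * |𝔼 u : κ → F, A M (tupleMap M' u)|
        ≤ I M M' * (t + t * (Y M M' / t) ^ (2 * p) + R M M') := by gcongr; linarith
      _ = t * I M M' + I M M' * (t * (Y M M' / t) ^ (2 * p)) + I M M' * R M M' := by ring
      _ ≤ _ := by
        have e1 := mul_le_of_le_one_left h3 (hI1 M M')
        have e2 := mul_le_of_le_one_left (hR0 M M') (hI1 M M')
        linarith
  have hAbs : ∀ M v, |A M v| ≤ 𝔼 x : ι → F, |g (v + tupleMap M x)| := fun M v => abs_expect_le _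
  have hR : 𝔼 M, 𝔼 M', R M M' ≤ s * ((S + q ^ (2 * p) * (1 / q ^ Fintype.card ι)) ^ (2 * p) /
      s ^ (2 * p)) := by
    have hg1 : 𝔼 v, |g v| ≤ S := by
      refine (expect_abs_le_sqrt g).trans_eq ?_
      rw [hgS, Real.sqrt_sq hS]
    have hmom : ∀ v, 𝔼 M : ι → V, |A M v| ^ (2 * p) ≤
        (S + q ^ (2 * p) * (1 / q ^ Fintype.card ι)) ^ (2 * p) := by
      intro v
      calc 𝔼 M : ι → V, |A M v| ^ (2 * p)
          ≤ 𝔼 M : ι → V, (𝔼 x : ι → F, |g (v + tupleMap M x)|) ^ (2 * p) :=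
            Finset.expect_le_expect fun M _ => pow_le_pow_left₀ (abs_nonneg _) (hAbs M v) _
        _ ≤ _ := expect_average_pow_le (fun v => |g v|) 1 (fun _ => abs_nonneg _) hg v _
        _ ≤ _ := by
          have : 0 ≤ 𝔼 v, |g v| := Finset.expect_nonneg fun _ _ => abs_nonneg _
          gcongr
    calc 𝔼 M, 𝔼 M', R M M'
        = 𝔼 M', 𝔼 u : κ → F, 𝔼 M, s * (|A M (tupleMap M' u)| / s) ^ (2 * p) := by
          rw [Finset.expect_comm]
          exact Finset.expect_congr rfl fun M' _ => Finset.expect_comm _ _ _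
      _ ≤ 𝔼 _M' : κ → V, 𝔼 _u : κ → F,
            s * ((S + q ^ (2 * p) * (1 / q ^ Fintype.card ι)) ^ (2 * p) / s ^ (2 * p)) := by
          refine Finset.expect_le_expect fun M' _ => Finset.expect_le_expect fun u _ => ?_
          rw [← Finset.mul_expect]
          simp only [div_pow]
          rw [← Finset.expect_div]
          gcongr
          exact hmom _
      _ = _ := by rw [Fintype.expect_const, Fintype.expect_const]
  have hY : 𝔼 M, 𝔼 M', t * (Y M M' / t) ^ (2 * p) ≤
      t * (2 ^ (2 * p) * ((S ^ 2 / q ^ Fintype.card ι + q ^ p * w) ^ p +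
        (q ^ (2 * p) * (s / q ^ Fintype.card κ)) ^ (2 * p)) / t ^ (2 * p)) := by
    have hM : ∀ M, 𝔼 M', Y M M' ^ (2 * p) ≤ 2 ^ (2 * p) * ((𝔼 v, A M v ^ 2) ^ p +
        (q ^ (2 * p) * (s / q ^ Fintype.card κ)) ^ (2 * p)) := by
      intro M
      have h1 := expect_average_pow_le (F := F) (ι := κ) (fun v => min |A M v| s) s
        (fun _ => le_min (abs_nonneg _) hs.le) (fun _ => min_le_right _ _) 0 (2 * p)
      simp only [zero_add] at h1
      have h2 : 𝔼 v, min |A M v| s ≤ √(𝔼 v, A M v ^ 2) :=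
        (Finset.expect_le_expect fun v _ => min_le_left _ _).trans (expect_abs_le_sqrt _)
      have h0 : 0 ≤ 𝔼 v, min |A M v| s :=
        Finset.expect_nonneg fun _ _ => le_min (abs_nonneg _) hs.le
      have h3 : 0 ≤ 𝔼 v, A M v ^ 2 := Finset.expect_nonneg fun _ _ => sq_nonneg _
      calc 𝔼 M', Y M M' ^ (2 * p) ≤ _ := h1
        _ ≤ (√(𝔼 v, A M v ^ 2) + q ^ (2 * p) * (s / q ^ Fintype.card κ)) ^ (2 * p) := by gcongr
        _ ≤ 2 ^ (2 * p - 1) * (√(𝔼 v, A M v ^ 2) ^ (2 * p) +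
              (q ^ (2 * p) * (s / q ^ Fintype.card κ)) ^ (2 * p)) :=
            add_pow_le (Real.sqrt_nonneg _) (by positivity) _
        _ ≤ _ := by
          rw [pow_mul (√_), Real.sq_sqrt h3]
          gcongr
          · norm_num
          · omega
    have hN := expect_norm_average_pow_le (ι := ι) χ hχ g w hw p
    rw [hgS] at hN
    calc 𝔼 M, 𝔼 M', t * (Y M M' / t) ^ (2 * p)
        = 𝔼 M, t * ((𝔼 M', Y M M' ^ (2 * p)) / t ^ (2 * p)) := by
          refine Finset.expect_congr rfl fun M _ => ?_
          rw [← Finset.mul_expect]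
          simp only [div_pow]
          rw [← Finset.expect_div]
      _ ≤ 𝔼 M, t * (2 ^ (2 * p) * ((𝔼 v, A M v ^ 2) ^ p +
            (q ^ (2 * p) * (s / q ^ Fintype.card κ)) ^ (2 * p)) / t ^ (2 * p)) := by
          refine Finset.expect_le_expect fun M _ => ?_
          have := hM M
          gcongr
      _ = t * (2 ^ (2 * p) * ((𝔼 M, (𝔼 v, A M v ^ 2) ^ p) +
            (q ^ (2 * p) * (s / q ^ Fintype.card κ)) ^ (2 * p)) / t ^ (2 * p)) := by
          rw [← Finset.mul_expect, ← Finset.expect_div, ← Finset.mul_expect,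
            Finset.expect_add_distrib, Fintype.expect_const]
      _ ≤ _ := by gcongr
  calc 𝔼 M, 𝔼 M', I M M' * |𝔼 u : κ → F, 𝔼 x : ι → F, g (tupleMap M' u + tupleMap M x)|
      ≤ 𝔼 M, 𝔼 M', (t * I M M' + t * (Y M M' / t) ^ (2 * p) + R M M') :=
        Finset.expect_le_expect fun M _ => Finset.expect_le_expect fun M' _ => hpt M M'
    _ = t * (𝔼 M, 𝔼 M', I M M') + (𝔼 M, 𝔼 M', t * (Y M M' / t) ^ (2 * p)) +
          𝔼 M, 𝔼 M', R M M' := by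
        simp only [Finset.expect_add_distrib, Finset.mul_expect]
    _ ≤ _ := by gcongr

end Core

section Counting

variable {F : Type*} [Field F] {V : Type*} [AddCommGroup V] [Module F V] {J : Type*} [Fintype J]

lemma exists_linearEquiv_apply_eq {z z' : V} (hz : z ≠ 0) (hz' : z' ≠ 0) :
    ∃ e : V ≃ₗ[F] V, e z = z' := by
  obtain ⟨g, hg⟩ := Submodule.exists_linearEquiv_restrict_eq
    ((LinearEquiv.toSpanNonzeroSingleton F V z hz).symm ≪≫ₗ
      LinearEquiv.toSpanNonzeroSingleton F V z' hz')
  refine ⟨g, ?_⟩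
  rw [← hg ⟨z, Submodule.mem_span_singleton_self z⟩]
  have : (LinearEquiv.toSpanNonzeroSingleton F V z hz).symm
      ⟨z, Submodule.mem_span_singleton_self z⟩ = 1 := by
    rw [LinearEquiv.symm_apply_eq]
    ext
    simp
  simp [this]

open scoped Classical in
lemma card_mem_eq [Fintype (Submodule F V)] (k : ℕ) {z z' : V} (hz : z ≠ 0) (hz' : z' ≠ 0) :
    (Finset.univ.filter fun L : Submodule F V => finrank F L = k ∧ z ∈ L).card =
      (Finset.univ.filter fun L : Submodule F V => finrank F L = k ∧ z' ∈ L).card := by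
  obtain ⟨e, he⟩ := exists_linearEquiv_apply_eq (F := F) hz hz'
  refine Finset.card_bij' (fun L _ => L.map e.toLinearMap) (fun L _ => L.map e.symm.toLinearMap)
    ?_ ?_ ?_ ?_
  · intro L hL
    simp only [Finset.mem_filter, Finset.mem_univ, true_and] at hL ⊢
    refine ⟨?_, z, hL.2, he⟩
    rw [← hL.1]
    exact LinearEquiv.finrank_map_eq e L
  · intro L hL
    simp only [Finset.mem_filter, Finset.mem_univ, true_and] at hL ⊢
    refine ⟨?_, z', hL.2, by simp [← he]⟩
    rw [← hL.1]
    exact LinearEquiv.finrank_map_eq e.symm L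
  · intro L _
    rw [← Submodule.map_comp]
    simp
  · intro L _
    rw [← Submodule.map_comp]
    simp

/-- The number of `J`-indexed bases of a space of dimension `card J`. -/
noncomputable def frameCount (F J : Type*) [Field F] : ℕ :=
  Nat.card {N : J → (J → F) // LinearIndependent F N}

lemma card_frames_eq [FiniteDimensional F V] (L : Submodule F V) (hL : finrank F L = Fintype.card J) :
    Nat.card {N : J → V // LinearIndependent F N ∧ Submodule.span F (Set.range N) = L} =
      frameCount F J := by
  have e : (J → F) ≃ₗ[F] L := LinearEquiv.ofFinrankEq _ _ (by simp [hL])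
  have hinj : LinearMap.ker (L.subtype ∘ₗ e.toLinearMap) = ⊥ := by
    rw [LinearMap.ker_eq_bot]
    exact L.injective_subtype.comp e.injective
  symm
  refine Nat.card_congr (Equiv.ofBijective (fun N => ⟨fun j => (e (N.1 j) : V), ?_, ?_⟩) ⟨?_, ?_⟩)
  · exact N.2.map' (L.subtype ∘ₗ e.toLinearMap) hinj
  · have hli : LinearIndependent F (fun j => (e (N.1 j) : V)) :=
      N.2.map' (L.subtype ∘ₗ e.toLinearMap) hinj
    refine Submodule.eq_of_le_of_finrank_eq ?_ ?_
    · rw [Submodule.span_le]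
      rintro _ ⟨j, rfl⟩
      exact (e (N.1 j)).2
    · rw [finrank_span_eq_card hli, hL]
  · intro N N' h
    ext1
    funext j
    have := congr_fun (congr_arg Subtype.val h) j
    exact e.injective (Subtype.ext this)
  · rintro ⟨N, hN, hsp⟩
    have hmem : ∀ j, N j ∈ L := fun j => hsp ▸ Submodule.subset_span ⟨j, rfl⟩
    refine ⟨⟨fun j => e.symm ⟨N j, hmem j⟩, ?_⟩, ?_⟩
    · apply LinearIndependent.of_comp (L.subtype ∘ₗ e.toLinearMap)
      convert hN using 1
      ext j
      simp
    · ext j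
      simp

variable [Fintype V]

open scoped Classical in
lemma sum_frames [DecidableEq J] [Fintype (Submodule F V)] (H : Submodule F V → ℝ) :
    ∑ N : J → V, (if LinearIndependent F N then H (Submodule.span F (Set.range N)) else 0) =
      frameCount F J * ∑ L ∈ Finset.univ.filter (fun L : Submodule F V => finrank F L = Fintype.card J), H L := by
  rw [← Finset.sum_filter, Finset.mul_sum]
  rw [← Finset.sum_fiberwise_of_maps_to
    (t := Finset.univ.filter fun L : Submodule F V => finrank F L = Fintype.card J)
    (g := fun N : J → V => Submodule.span F (Set.range N))]
  · refine Finset.sum_congr rfl fun L hL => ?_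
    rw [Finset.sum_congr rfl (g := fun _ => H L) fun N hN => by rw [(Finset.mem_filter.1 hN).2],
      Finset.sum_const, nsmul_eq_mul, ← card_frames_eq (J := J) L (Finset.mem_filter.1 hL).2,
      Nat.card_eq_fintype_card, Fintype.card_subtype, Finset.filter_filter]
  · intro N hN
    simpa using finrank_span_eq_card (Finset.mem_filter.1 hN).2

variable [Fintype F]

open scoped Classical in
lemma sum_tupleMap [DecidableEq J] (N : J → V) (hN : LinearIndependent F N) (g : V → ℝ) :
    ∑ a : J → F, g (tupleMap N a) = ∑ z with z ∈ Submodule.span F (Set.range N), g z := by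
  have hinj : Function.Injective (tupleMap (F := F) N) :=
    hN.fintypeLinearCombination_injective
  rw [← Finset.sum_image (f := g) (s := Finset.univ) (g := fun a => tupleMap (F := F) N a)
    fun a _ b _ h => hinj h]
  refine Finset.sum_congr ?_ fun _ _ => rfl
  ext z
  simp only [Finset.mem_image, Finset.mem_univ, true_and, Finset.mem_filter]
  rw [← Fintype.range_linearCombination F N]
  rfl

open scoped Classical in
lemma card_mem_submodule (L : Submodule F V) :
    (Finset.univ.filter (· ∈ L)).card = Fintype.card F ^ finrank F L := by
  rw [← Module.card_eq_pow_finrank (K := F) (V := L)]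
  exact (Fintype.card_subtype _).symm

open scoped Classical in
/-- Double counting of pairs of a point and a subspace in a family containing it. -/
lemma sum_card_mem (𝓢 : Finset (Submodule F V)) (k : ℕ) (h𝓢 : ∀ L ∈ 𝓢, finrank F L = k) :
    ∑ z : V, ((𝓢.filter (z ∈ ·)).card : ℝ) = 𝓢.card * (Fintype.card F : ℝ) ^ k := by
  simp only [Finset.card_filter, Nat.cast_sum]
  rw [Finset.sum_comm, Finset.sum_congr rfl (g := fun _ => (Fintype.card F : ℝ) ^ k),
    Finset.sum_const, nsmul_eq_mul]
  intro L hL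
  rw [← h𝓢 L hL, ← Nat.cast_sum, ← Finset.card_filter, card_mem_submodule]
  push_cast
  rfl

lemma frameCount_pos : 0 < frameCount F J := by
  have : Nonempty {N : J → (J → F) // LinearIndependent F N} :=
    ⟨⟨Pi.basisFun F J, (Pi.basisFun F J).linearIndependent⟩⟩
  exact Nat.card_pos

open scoped Classical in
lemma card_linearIndependent_ker_le (α : Dual F V) (hα : α ≠ 0) :
    Fintype.card {N : J → V // LinearIndependent F N ∧ ∀ j, α (N j) = 0} *
      Fintype.card F ^ Fintype.card J ≤ Fintype.card {N : J → V // LinearIndependent F N} := by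
  classical
  obtain ⟨v, hv⟩ : ∃ v, α v = 1 := by
    obtain ⟨u, hu⟩ := DFunLike.ne_iff.1 hα
    exact ⟨(α u)⁻¹ • u, by simpa using inv_mul_cancel₀ hu⟩
  rw [← Fintype.card_fun, ← Fintype.card_prod]
  refine Fintype.card_le_of_injective
    (fun x => ⟨fun j => x.1.1 j + x.2 j • v, ?_⟩) fun x y hxy => ?_
  · obtain ⟨⟨N, hN, hker⟩, a⟩ := x
    rw [Fintype.linearIndependent_iff] at hN ⊢
    intro c hc
    have h0 : ∑ j, c j * a j = 0 := by
      simpa [hker, hv] using congr_arg α hc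
    refine hN c ?_
    simpa [smul_add, Finset.sum_add_distrib, smul_smul, ← Finset.sum_smul, h0] using hc
  · obtain ⟨⟨N, hN, hker⟩, a⟩ := x
    obtain ⟨⟨N', hN', hker'⟩, a'⟩ := y
    have h : ∀ j, N j + a j • v = N' j + a' j • v := fun j =>
      congr_fun (congr_arg Subtype.val hxy) j
    have ha : a = a' := by
      ext j
      simpa [hker, hker', hv] using congr_arg α (h j)
    subst ha
    have hNN : N = N' := by
      ext j
      simpa using h j
    subst hNN
    rfl

open scoped Classical in
lemma card_le_ker_le [Fintype (Submodule F V)] (k : ℕ) (α : Dual F V) (hα : α ≠ 0) :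
    ((Finset.univ.filter fun L : Submodule F V =>
      finrank F L = k ∧ L ≤ LinearMap.ker α).card : ℝ) * (Fintype.card F : ℝ) ^ k ≤
      (Finset.univ.filter fun L : Submodule F V => finrank F L = k).card := by
  have h1 := sum_frames (F := F) (V := V) (J := Fin k) fun _ => 1
  have h2 := sum_frames (F := F) (V := V) (J := Fin k) fun L =>
    if L ≤ LinearMap.ker α then 1 else 0
  have h3 := card_linearIndependent_ker_le (J := Fin k) α hα
  have hpos : (0 : ℝ) < frameCount F (Fin k) := by exact_mod_cast frameCount_pos
  simp only [← ite_and, Submodule.span_le, Set.range_subset_iff, SetLike.mem_coe,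
    LinearMap.mem_ker] at h2
  rw [Fintype.card_subtype, Fintype.card_subtype, Fintype.card_fin] at h3
  rw [← Finset.sum_filter, Finset.sum_const, Finset.sum_const, nsmul_eq_mul, nsmul_eq_mul, mul_one,
    mul_one, Fintype.card_fin] at h1
  rw [← Finset.sum_filter, ← Finset.sum_filter, Finset.sum_const, Finset.sum_const, nsmul_eq_mul,
    nsmul_eq_mul, mul_one, mul_one, Fintype.card_fin, Finset.filter_filter] at h2
  refine le_of_mul_le_mul_left ?_ hpos
  rw [← mul_assoc, ← h1, ← h2]
  exact_mod_cast h3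

open scoped Classical in
/-- At least half of all tuples of length `k < dim V` are linearly independent. -/
lemma card_pow_le_two_mul_card_linearIndependent (hJ : Fintype.card J + 1 ≤ finrank F V) :
    (Fintype.card V : ℝ) ^ Fintype.card J ≤
      2 * ∑ N : J → V, (if LinearIndependent F N then 1 else 0 : ℝ) := by
  have hF : (2 : ℝ) ≤ Fintype.card F := by exact_mod_cast Fintype.one_lt_card (α := F)
  have hV : (Fintype.card V : ℝ) = (Fintype.card F : ℝ) ^ finrank F V := by
    exact_mod_cast Module.card_eq_pow_finrank (K := F) (V := V)
  have hV0 : (0 : ℝ) < Fintype.card V := by rw [hV]; positivity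
  have h1 : ∑ N : J → V, (if LinearIndependent F N then 1 else 0 : ℝ) =
      ∏ i : Fin (Fintype.card J), ((Fintype.card V : ℝ) - (Fintype.card F : ℝ) ^ (i : ℕ)) := by
    have hc := card_linearIndependent (K := F) (V := V) (k := Fintype.card J) (by omega)
    rw [← Finset.sum_filter, Finset.sum_const, nsmul_one, ← Fintype.card_subtype,
      ← Nat.card_eq_fintype_card,
      Nat.card_congr (Equiv.subtypeEquiv (q := fun N : Fin (Fintype.card J) → V =>
        LinearIndependent F N) (Equiv.arrowCongr (Fintype.equivFin J) (Equiv.refl V))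
        fun N => (linearIndependent_equiv (Fintype.equivFin J).symm).symm), hc, Nat.cast_prod]
    refine Finset.prod_congr rfl fun i _ => ?_
    rw [Nat.cast_sub, Nat.cast_pow, Nat.cast_pow, hV]
    exact Nat.pow_le_pow_right Fintype.card_pos (by omega)
  have hprod : ∀ m ≤ Fintype.card J, (Fintype.card V : ℝ) ^ m *
      ((Fintype.card V : ℝ) - (Fintype.card F : ℝ) ^ m) ≤
      Fintype.card V * ∏ i ∈ Finset.range m,
        ((Fintype.card V : ℝ) - (Fintype.card F : ℝ) ^ i) := by
    intro m hm
    induction m with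
    | zero => simp
    | succ m ih =>
      have hqm : (Fintype.card F : ℝ) ^ m ≤ Fintype.card V := by
        rw [hV]; exact pow_le_pow_right₀ (by linarith) (by omega)
      have := mul_le_mul_of_nonneg_right (ih (by omega)) (sub_nonneg.2 hqm)
      rw [Finset.prod_range_succ, ← mul_assoc]
      refine le_trans ?_ this
      rw [pow_succ, pow_succ, mul_assoc, mul_assoc]
      refine mul_le_mul_of_nonneg_left ?_ (pow_nonneg hV0.le m)
      have h0 : (0 : ℝ) < (Fintype.card F : ℝ) ^ m := by positivity
      nlinarith [mul_pos h0 hV0, mul_le_mul_of_nonneg_left hF (mul_pos h0 hV0).le]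
  have hle : 2 * (Fintype.card F : ℝ) ^ Fintype.card J ≤ Fintype.card V := by
    rw [hV]
    calc _ ≤ (Fintype.card F : ℝ) ^ (Fintype.card J + 1) := by
          rw [pow_succ, mul_comm]; gcongr
      _ ≤ _ := pow_le_pow_right₀ (by linarith) hJ
  rw [h1, Fin.prod_univ_eq_prod_range fun i => (Fintype.card V : ℝ) - (Fintype.card F : ℝ) ^ i]
  refine le_of_mul_le_mul_left ?_ hV0
  have := hprod _ le_rfl
  have h2 := mul_le_mul_of_nonneg_left hle (pow_nonneg hV0.le (Fintype.card J))
  linarith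

end Counting

section Deviation

open scoped Classical in
lemma sum_addChar_linearMap {F E : Type*} [Field F] [AddCommGroup E] [Module F E] [Fintype E]
    (χ : AddChar F ℂ) (hχ : χ ≠ 0) (β : E →ₗ[F] F) :
    ∑ x, χ (β x) = if β = 0 then (Fintype.card E : ℂ) else 0 := by
  have := expect_addChar_linearMap χ hχ β
  rw [Fintype.expect_eq_sum_div_card, div_eq_iff (by simp)] at this
  rw [this]
  split_ifs <;> simp

variable {F : Type*} [Field F] {V : Type*} [AddCommGroup V] [Module F V]

open scoped Classical in
/-- The deviation from `η` of the local density at a nonzero point `z` of a family `𝓖` of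
subspaces, when `r` is the number of admissible subspaces through `z`. -/
noncomputable def pointDeviation (𝓖 : Finset (Submodule F V)) (r η : ℝ) (z : V) : ℝ :=
  if z = 0 then 0 else ((𝓖.filter (z ∈ ·)).card : ℝ) / r - η

variable (𝓖 : Finset (Submodule F V)) {r η ε : ℝ}

open scoped Classical in
lemma abs_pointDeviation_le (hr : 0 < r) (hη : 0 < η) (hηε : η ≤ ε)
    (hpt : ∀ z : V, z ≠ 0 → pointDeviation 𝓖 r η z + η ≤ ε) (z : V) :
    |pointDeviation 𝓖 r η z| ≤ ε := by
  rw [abs_le]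
  have hε : 0 < ε := hη.trans_le hηε
  by_cases hz : z = 0
  · simp [pointDeviation, hz, hε.le]
  · refine ⟨?_, by linarith [hpt z hz]⟩
    rw [pointDeviation, if_neg hz]
    have : 0 ≤ ((𝓖.filter (z ∈ ·)).card : ℝ) / r := by positivity
    linarith

variable [Fintype V]

open scoped Classical in
lemma sum_pointDeviation_mul {R : Type*} [Field R] [Algebra ℝ R] (h : V → R) :
    ∑ z, algebraMap ℝ R (pointDeviation 𝓖 r η z) * h z =
      (∑ L ∈ 𝓖, ∑ z with z ∈ L, h z) * algebraMap ℝ R r⁻¹ - algebraMap ℝ R η * ∑ z, h z -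
        algebraMap ℝ R (𝓖.card / r - η) * h 0 := by
  have h1 : ∀ z, algebraMap ℝ R (pointDeviation 𝓖 r η z) * h z =
      (∑ L ∈ 𝓖, if z ∈ L then h z else 0) * algebraMap ℝ R r⁻¹ - algebraMap ℝ R η * h z -
        if z = 0 then algebraMap ℝ R (𝓖.card / r - η) * h 0 else 0 := by
    intro z
    rw [← Finset.sum_filter, Finset.sum_const, nsmul_eq_mul]
    by_cases hz : z = 0
    · simp [pointDeviation, hz, div_eq_mul_inv, sub_mul]
      ring
    · simp [pointDeviation, hz, div_eq_mul_inv, sub_mul]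
      ring
  simp_rw [h1]
  rw [Finset.sum_sub_distrib, Finset.sum_sub_distrib, ← Finset.sum_mul, ← Finset.mul_sum,
    Finset.sum_comm, Finset.sum_ite_eq' _ _ fun _ => _]
  simp only [Finset.mem_univ, if_true]
  congr 3
  refine Finset.sum_congr rfl fun L _ => ?_
  rw [← Finset.sum_filter]

variable [Fintype F] {k : ℕ}

open scoped Classical in
lemma sum_pointDeviation (h𝓖 : ∀ L ∈ 𝓖, finrank F L = k) {D : ℝ}
    (hD : r * (Fintype.card V - 1) = D * ((Fintype.card F : ℝ) ^ k - 1)) (hr : 0 < r)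
    (hη : (𝓖.card : ℝ) = η * D) : ∑ z, pointDeviation 𝓖 r η z = 0 := by
  have h := sum_pointDeviation_mul (r := r) (η := η) 𝓖 (fun _ : V => (1 : ℝ))
  simp only [mul_one, Algebra.algebraMap_self, RingHom.id_apply] at h
  rw [h, Finset.sum_congr rfl (g := fun _ => (Fintype.card F : ℝ) ^ k), Finset.sum_const,
    Finset.sum_const, nsmul_eq_mul, Finset.card_univ, nsmul_eq_mul, mul_one, hη]
  · field_simp
    linear_combination (-η) * hD
  · intro L hL
    rw [Finset.sum_const, nsmul_eq_mul, mul_one, card_mem_submodule, h𝓖 L hL, Nat.cast_pow]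

open scoped Classical in
lemma sum_pointDeviation_mul_addChar (χ : AddChar F ℂ) (hχ : χ ≠ 0)
    (h𝓖 : ∀ L ∈ 𝓖, finrank F L = k) (α : Dual F V) (hα : α ≠ 0) :
    ∑ z, (pointDeviation 𝓖 r η z : ℂ) * χ (α z) =
      (((Fintype.card F : ℝ) ^ k * (𝓖.filter (· ≤ LinearMap.ker α)).card / r -
        (𝓖.card / r - η) : ℝ) : ℂ) := by
  have h := sum_pointDeviation_mul (r := r) (η := η) 𝓖 (fun z : V => χ (α z))
  simp only [Complex.coe_algebraMap] at h
  rw [h, sum_addChar_linearMap χ hχ α, if_neg hα]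
  rw [Finset.sum_congr rfl (g := fun L => if L ≤ LinearMap.ker α then
    (Fintype.card F : ℂ) ^ k else 0), ← Finset.sum_filter, Finset.sum_const, nsmul_eq_mul]
  · simp
    ring
  · intro L hL
    have h0 : (α.domRestrict L = 0) ↔ L ≤ LinearMap.ker α := by
      rw [LinearMap.ext_iff, SetLike.le_def]
      simp
    have := sum_addChar_linearMap χ hχ (α.domRestrict L)
    simp only [LinearMap.domRestrict_apply] at this
    rw [Finset.sum_subtype (p := (· ∈ L)) _ (by simp), this, Module.card_eq_pow_finrank (K := F) (V := L), h𝓖 L hL]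
    simp [h0]

open scoped Classical in
lemma sum_pointDeviation_sq (h𝓖 : ∀ L ∈ 𝓖, finrank F L = k) {D : ℝ}
    (hD : r * (Fintype.card V - 1) = D * ((Fintype.card F : ℝ) ^ k - 1)) (hr : 0 < r)
    (hη : (𝓖.card : ℝ) = η * D) :
    ∑ z, pointDeviation 𝓖 r η z ^ 2 =
      (∑ L ∈ 𝓖, ∑ z with z ∈ L, pointDeviation 𝓖 r η z) / r := by
  have h := sum_pointDeviation_mul (r := r) (η := η) 𝓖 (pointDeviation 𝓖 r η)
  simp only [Algebra.algebraMap_self, RingHom.id_apply] at h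
  rw [sum_pointDeviation 𝓖 h𝓖 hD hr hη] at h
  simp_rw [sq]
  rw [h]
  simp [pointDeviation, div_eq_mul_inv]

end Deviation

section Variance

variable {F : Type*} [Field F] {V : Type*} [AddCommGroup V] [Module F V] [Fintype V]
  {k : ℕ} {r D η ε : ℝ}

open scoped Classical in
lemma frameCount_mul_sum (J : Type*) [Fintype J] [DecidableEq J]
    (hJ : Fintype.card J = k) (𝓖 : Finset (Submodule F V))
    (h𝓖 : ∀ L ∈ 𝓖, finrank F L = k) (H : Submodule F V → ℝ) :
    frameCount F J * ∑ L ∈ 𝓖, H L =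
      ∑ N : J → V, (if LinearIndependent F N ∧ Submodule.span F (Set.range N) ∈ 𝓖 then 1 else 0) *
        H (Submodule.span F (Set.range N)) := by
  have : Fintype (Submodule F V) := Fintype.ofFinite _
  have h := sum_frames (F := F) (V := V) (J := J) fun L => if L ∈ 𝓖 then H L else 0
  have h𝓖' : Finset.univ.filter (fun L : Submodule F V => finrank F L = Fintype.card J ∧ L ∈ 𝓖) =
      𝓖 := by
    ext L
    simp only [Finset.mem_filter, Finset.mem_univ, true_and, hJ]
    exact ⟨fun h => h.2, fun h => ⟨h𝓖 L h, h⟩⟩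
  rw [← Finset.sum_filter (p := (· ∈ 𝓖)), Finset.filter_filter, h𝓖'] at h
  rw [← h]
  refine Finset.sum_congr rfl fun N _ => ?_
  simp only [ite_and, ite_mul, one_mul, zero_mul]

variable [Fintype F]

open scoped Classical in
lemma mul_card_sub_one_eq [Fintype (Submodule F V)]
    (hr : ∀ z : V, z ≠ 0 →
      ((Finset.univ.filter fun L : Submodule F V => finrank F L = k ∧ z ∈ L).card : ℝ) = r)
    (hD : ((Finset.univ.filter fun L : Submodule F V => finrank F L = k).card : ℝ) = D) :
    r * (Fintype.card V - 1) = D * ((Fintype.card F : ℝ) ^ k - 1) := by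
  have h := sum_card_mem (F := F) (V := V)
    (Finset.univ.filter fun L : Submodule F V => finrank F L = k) k (by simp)
  rw [← Finset.add_sum_erase _ _ (Finset.mem_univ (0 : V)), hD,
    Finset.sum_congr rfl (g := fun _ => r), Finset.sum_const,
    Finset.card_erase_of_mem (Finset.mem_univ _), Finset.card_univ, nsmul_eq_mul,
    Nat.cast_sub Fintype.card_pos] at h
  · simp only [Submodule.zero_mem, Finset.filter_true, hD] at h
    push_cast at h
    linarith
  · intro z hz
    rw [Finset.filter_filter]
    exact hr z (Finset.ne_of_mem_erase hz)

open scoped Classical in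
lemma frameCount_mul_card_bounds [Fintype (Submodule F V)] (J : Type*) [Fintype J]
    (hJ : Fintype.card J = k) (hk : k + 1 ≤ finrank F V)
    (hD : ((Finset.univ.filter fun L : Submodule F V => finrank F L = k).card : ℝ) = D) :
    (Fintype.card V : ℝ) ^ k ≤ 2 * (frameCount F J * D) ∧
      frameCount F J * D ≤ (Fintype.card V : ℝ) ^ k := by
  have h1 := sum_frames (F := F) (V := V) (J := J) fun _ => 1
  have h2 := card_pow_le_two_mul_card_linearIndependent (F := F) (V := V) (J := J) (hJ ▸ hk)
  rw [Finset.sum_const, nsmul_eq_mul, mul_one, hJ, hD] at h1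
  rw [← h1, ← hJ]
  refine ⟨by convert h2, ?_⟩
  rw [← Finset.sum_filter, Finset.sum_const, nsmul_one, ← Nat.cast_pow, Nat.cast_le,
    ← Fintype.card_fun, ← Finset.card_univ]
  exact Finset.card_filter_le _ _

open scoped Classical in
lemma normSq_dualFourier_pointDeviation_le (𝓖 : Finset (Submodule F V)) (χ : AddChar F ℂ)
    (hχ : χ ≠ 0) (h𝓖 : ∀ L ∈ 𝓖, finrank F L = k) (hr : 0 < r) (hη0 : 0 < η) (hηε : η ≤ ε)
    (hrD : r ≤ D) (hDr : (Fintype.card F : ℝ) ^ k * D ≤ 2 * Fintype.card V * r)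
    (hDQ : r * (Fintype.card V - 1) = D * ((Fintype.card F : ℝ) ^ k - 1))
    (hη : (𝓖.card : ℝ) = η * D)
    (hker : ∀ α : Dual F V, α ≠ 0 → (Fintype.card F : ℝ) ^ k *
      (𝓖.filter (· ≤ LinearMap.ker α)).card ≤ ε * D) (α : Dual F V) :
    Complex.normSq (dualFourier χ (fun z => pointDeviation 𝓖 r η z / ε) α) ≤
      (2 / (Fintype.card F : ℝ) ^ k) ^ 2 := by
  have hε : 0 < ε := hη0.trans_le hηε
  have hQ : (0 : ℝ) < Fintype.card V := by exact_mod_cast Fintype.card_pos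
  have hq : (0 : ℝ) < (Fintype.card F : ℝ) ^ k := by
    have : (0 : ℝ) < Fintype.card F := by exact_mod_cast Fintype.card_pos
    positivity
  have hD0 : 0 < D := hr.trans_le hrD
  have key : ∃ X : ℝ, ∑ z, (pointDeviation 𝓖 r η z : ℂ) * χ (α z) = (X : ℂ) ∧
      |X| ≤ ε * D / r := by
    by_cases hα : α = 0
    · refine ⟨0, ?_, by simp; positivity⟩
      subst hα
      simp [← Complex.ofReal_sum, sum_pointDeviation 𝓖 h𝓖 hDQ hr hη]
    · refine ⟨_, sum_pointDeviation_mul_addChar 𝓖 χ hχ h𝓖 α hα, ?_⟩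
      have h1 := hker α hα
      have h0 : 0 ≤ (Fintype.card F : ℝ) ^ k * (𝓖.filter (· ≤ LinearMap.ker α)).card := by
        positivity
      set m := (Fintype.card F : ℝ) ^ k * (𝓖.filter (· ≤ LinearMap.ker α)).card
      have h2 : m / r - (𝓖.card / r - η) = (m - η * D + η * r) / r := by
        rw [hη]; field_simp; ring
      rw [h2, abs_div, abs_of_pos hr]
      gcongr
      rw [abs_le]
      constructor <;> nlinarith
  obtain ⟨X, hX, hXle⟩ := key
  have : dualFourier χ (fun z => pointDeviation 𝓖 r η z / ε) α =
      ((X / (ε * Fintype.card V) : ℝ) : ℂ) := by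
    rw [dualFourier, Fintype.expect_eq_sum_div_card]
    push_cast
    rw [← hX, Finset.sum_div, Finset.sum_div]
    refine Finset.sum_congr rfl fun z _ => ?_
    field_simp
  rw [this, Complex.normSq_ofReal, ← sq]
  rw [sq_le_sq, abs_of_pos (a := 2 / _) (by positivity), abs_div,
    abs_of_pos (a := ε * _) (by positivity), div_le_div_iff₀ (by positivity) hq]
  rw [le_div_iff₀ hr] at hXle
  refine le_of_mul_le_mul_right ?_ hr
  nlinarith [mul_le_mul_of_nonneg_right hXle hq.le, mul_le_mul_of_nonneg_left hDr hε.le]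

open scoped Classical in
lemma frameCount_mul_sum_sum (J : Type*) [Fintype J] [DecidableEq J]
    (hJ : Fintype.card J = k) (𝓖 : Finset (Submodule F V))
    (h𝓖 : ∀ L ∈ 𝓖, finrank F L = k) (g : V → ℝ) :
    frameCount F J * ∑ L ∈ 𝓖, ∑ z with z ∈ L, g z =
      ∑ N : J → V, (if LinearIndependent F N ∧ Submodule.span F (Set.range N) ∈ 𝓖 then 1 else 0) *
        ∑ a : J → F, g (tupleMap N a) := by
  rw [frameCount_mul_sum J hJ 𝓖 h𝓖 fun L => ∑ z with z ∈ L, g z]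
  refine Finset.sum_congr rfl fun N _ => ?_
  by_cases hN : LinearIndependent F N
  · rw [sum_tupleMap N hN]
  · simp [hN]

end Variance

section Split

variable {F : Type*} [Field F] [Fintype F] {V : Type*} [AddCommGroup V] [Module F V] [Fintype V]
  {ι κ : Type*} [Fintype ι] [DecidableEq ι] [Fintype κ] [DecidableEq κ]

lemma expect_sumArrow {X : Type*} [Fintype X] (f : (ι ⊕ κ → X) → ℝ) :
    𝔼 N, f N = 𝔼 M : ι → X, 𝔼 M' : κ → X, f (Sum.elim M M') := by
  rw [← Finset.expect_product', Finset.univ_product_univ]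
  exact Fintype.expect_equiv (Equiv.sumArrowEquivProdArrow ι κ X) _ _ fun N => by
    congr 1
    ext i
    cases i <;> rfl

lemma expect_mul_expect_tupleMap_le (g : V → ℝ) (I : (ι ⊕ κ → V) → ℝ) (hI : ∀ N, 0 ≤ I N) :
    𝔼 N, I N * 𝔼 a : ι ⊕ κ → F, g (tupleMap N a) ≤
      𝔼 M, 𝔼 M', I (Sum.elim M M') *
        |𝔼 u : κ → F, 𝔼 x : ι → F, g (tupleMap M' u + tupleMap M x)| := by
  rw [expect_sumArrow]
  refine Finset.expect_le_expect fun M _ => Finset.expect_le_expect fun M' _ => ?_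
  refine mul_le_mul_of_nonneg_left (le_trans (le_of_eq ?_) (le_abs_self _)) (hI _)
  rw [expect_sumArrow, Finset.expect_comm]
  refine Finset.expect_congr rfl fun u _ => Finset.expect_congr rfl fun x _ => ?_
  simp [tupleMap_apply, add_comm]

open scoped Classical in
/-- The second moment bound for the point deviation of a pseudo-random family. -/
lemma exists_pointDeviation_bound [Fintype (Submodule F V)] {k : ℕ} {r D η ε : ℝ}
    (hk : Fintype.card ι + Fintype.card κ = k) (hk1 : 1 ≤ k) (hkn : k + 1 ≤ finrank F V)
    (𝓖 : Finset (Submodule F V)) (h𝓖 : ∀ L ∈ 𝓖, finrank F L = k)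
    (hr : ∀ z : V, z ≠ 0 →
      ((Finset.univ.filter fun L : Submodule F V => finrank F L = k ∧ z ∈ L).card : ℝ) = r)
    (hD : ((Finset.univ.filter fun L : Submodule F V => finrank F L = k).card : ℝ) = D)
    (hη : (𝓖.card : ℝ) = η * D) (hη0 : 0 < η) (hηε : η ≤ ε)
    (hpt : ∀ z : V, z ≠ 0 → pointDeviation 𝓖 r η z + η ≤ ε)
    (hker : ∀ α : Dual F V, α ≠ 0 → ((𝓖.filter (· ≤ LinearMap.ker α)).card : ℝ) ≤
      ε * (Finset.univ.filter fun L : Submodule F V =>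
        finrank F L = k ∧ L ≤ LinearMap.ker α).card) :
    ∃ S : ℝ, 0 ≤ S ∧ S ≤ 1 ∧
      ∑ z, pointDeviation 𝓖 r η z ^ 2 = Fintype.card V * (ε * S) ^ 2 ∧
      ∀ s t : ℝ, 0 < s → 0 < t → ∀ p : ℕ, p ≠ 0 → ε * S ^ 2 ≤
        4 * (t * η + t * (2 ^ (2 * p) * ((S ^ 2 / (Fintype.card F : ℝ) ^ Fintype.card ι +
          (Fintype.card F : ℝ) ^ p * (2 / (Fintype.card F : ℝ) ^ k) ^ 2) ^ p +
            ((Fintype.card F : ℝ) ^ (2 * p) *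
              (s / (Fintype.card F : ℝ) ^ Fintype.card κ)) ^ (2 * p)) / t ^ (2 * p)) +
          s * ((S + (Fintype.card F : ℝ) ^ (2 * p) *
            (1 / (Fintype.card F : ℝ) ^ Fintype.card ι)) ^ (2 * p) / s ^ (2 * p))) := by
  obtain ⟨χ, hχ⟩ : ∃ χ : AddChar F ℂ, χ ≠ 0 := by
    obtain ⟨χ, h⟩ := AddChar.exists_apply_ne_zero (α := F) (a := 1) |>.2 one_ne_zero
    exact ⟨χ, fun h0 => h (by simp [h0])⟩
  have hε : 0 < ε := hη0.trans_le hηε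
  have hQ : (0 : ℝ) < Fintype.card V := by exact_mod_cast Fintype.card_pos
  have hF : (2 : ℝ) ≤ Fintype.card F := by exact_mod_cast Fintype.one_lt_card (α := F)
  have hq2 : (2 : ℝ) ≤ (Fintype.card F : ℝ) ^ k :=
    hF.trans (le_self_pow₀ (by linarith) (by omega))
  have hQq : (Fintype.card F : ℝ) ^ k ≤ Fintype.card V := by
    rw [Module.card_eq_pow_finrank (K := F) (V := V), Nat.cast_pow]
    exact pow_le_pow_right₀ (by linarith) (by omega)
  have hDQ := mul_card_sub_one_eq hr hD
  obtain ⟨hγ1, hγ2⟩ := frameCount_mul_card_bounds (ι ⊕ κ) (by simpa using hk) hkn hD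
  have hγ : (0 : ℝ) < frameCount F (ι ⊕ κ) := by exact_mod_cast frameCount_pos
  have hD0 : 0 < D := by
    have : 0 < (Fintype.card V : ℝ) ^ k := by positivity
    by_contra! h
    nlinarith
  have hr0 : 0 < r := by
    by_contra! h
    nlinarith
  have hrD : r ≤ D := by
    by_contra! h
    nlinarith
  have hDr : (Fintype.card F : ℝ) ^ k * D ≤ 2 * Fintype.card V * r := by nlinarith
  have hker' : ∀ α : Dual F V, α ≠ 0 → (Fintype.card F : ℝ) ^ k *
      (𝓖.filter (· ≤ LinearMap.ker α)).card ≤ ε * D := by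
    intro α hα
    have h1 := card_le_ker_le k α hα
    rw [hD] at h1
    have h2 := mul_le_mul_of_nonneg_left h1 hε.le
    have h3 := mul_le_mul_of_nonneg_left (hker α hα) (by linarith : 0 ≤ (Fintype.card F : ℝ) ^ k)
    linarith
  set g : V → ℝ := fun z => pointDeviation 𝓖 r η z / ε with hg
  have hg1 : ∀ z, |g z| ≤ 1 := fun z => by
    rw [hg, abs_div, abs_of_pos hε, div_le_one hε]
    exact abs_pointDeviation_le 𝓖 hr0 hη0 hηε hpt z
  have hg0 : 0 ≤ 𝔼 z, g z ^ 2 := Finset.expect_nonneg fun z _ => sq_nonneg _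
  have hS2 := Real.sq_sqrt hg0
  have hsum : ∑ z, pointDeviation 𝓖 r η z ^ 2 =
      Fintype.card V * (ε * √(𝔼 z, g z ^ 2)) ^ 2 := by
    rw [mul_pow, hS2, Fintype.expect_eq_sum_div_card]
    simp only [hg, div_pow]
    rw [← Finset.sum_div]
    field_simp
  refine ⟨√(𝔼 z, g z ^ 2), Real.sqrt_nonneg _, ?_, hsum, fun s t hs ht p hp => ?_⟩
  · refine Real.sqrt_le_iff.2 ⟨zero_le_one, ?_⟩
    rw [one_pow]
    refine Finset.expect_le Finset.univ_nonempty fun z _ => ?_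
    rw [← sq_abs]
    exact pow_le_one₀ (abs_nonneg _) (hg1 z)
  let I : (ι ⊕ κ → V) → ℝ := fun N =>
    if LinearIndependent F N ∧ Submodule.span F (Set.range N) ∈ 𝓖 then 1 else 0
  have hI0 : ∀ N, 0 ≤ I N := fun N => by simp only [I]; split_ifs <;> simp
  have hI1 : ∀ N, I N ≤ 1 := fun N => by simp only [I]; split_ifs <;> simp
  have core := expect_mul_abs_average_le χ hχ g hg1 ((2 / (Fintype.card F : ℝ) ^ k) ^ 2)
    _ (Real.sqrt_nonneg _) hS2.symm
    (normSq_dualFourier_pointDeviation_le 𝓖 χ hχ h𝓖 hr0 hη0 hηε hrD hDr hDQ hη hker')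
    (fun (M : ι → V) (M' : κ → V) => I (Sum.elim M M')) (fun _ _ => hI0 _) (fun _ _ => hI1 _)
    s t hs ht p hp
  have split := expect_mul_expect_tupleMap_le (F := F) g I hI0
  rw [← expect_sumArrow] at core
  have hEI : 𝔼 N, I N ≤ η := by
    have h := frameCount_mul_sum (ι ⊕ κ) (by simpa using hk) 𝓖 h𝓖 fun _ => 1
    simp only [mul_one, Finset.sum_const, nsmul_eq_mul] at h
    rw [Fintype.expect_eq_sum_div_card, ← h, hη, Fintype.card_fun, Fintype.card_sum, hk,
      Nat.cast_pow, div_le_iff₀ (by positivity)]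
    nlinarith
  have hlow : ε * (𝔼 z, g z ^ 2) ≤ 4 * 𝔼 N, I N * 𝔼 a : ι ⊕ κ → F, g (tupleMap N a) := by
    have h := frameCount_mul_sum_sum (ι ⊕ κ) (by simpa using hk) 𝓖 h𝓖 g
    have h1 := sum_pointDeviation_sq 𝓖 h𝓖 hDQ hr0 hη
    have h2 : ∑ L ∈ 𝓖, ∑ z with z ∈ L, pointDeviation 𝓖 r η z =
        ε * ∑ L ∈ 𝓖, ∑ z with z ∈ L, g z := by
      simp only [Finset.mul_sum, hg]
      exact Finset.sum_congr rfl fun L _ => Finset.sum_congr rfl fun z _ => by field_simp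
    have h3 : 𝔼 N, I N * 𝔼 a : ι ⊕ κ → F, g (tupleMap N a) =
        (frameCount F (ι ⊕ κ) * ∑ L ∈ 𝓖, ∑ z with z ∈ L, g z) /
          ((Fintype.card F : ℝ) ^ k * Fintype.card V ^ k) := by
      rw [h, Fintype.expect_eq_sum_div_card]
      simp only [Fintype.expect_eq_sum_div_card, Fintype.card_fun, Fintype.card_sum, hk,
        Nat.cast_pow, I, ← mul_div_assoc]
      rw [← Finset.sum_div, div_div]
    rw [h2, hsum, mul_pow, hS2] at h1
    set B := ∑ L ∈ 𝓖, ∑ z with z ∈ L, g z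
    set T := 𝔼 z, g z ^ 2
    have h4 : r * (Fintype.card V * (ε * T)) = B := by
      field_simp at h1
      linear_combination h1
    rw [h3, ← h4]
    have h5 : (Fintype.card F : ℝ) ^ k * Fintype.card V ^ k ≤
        4 * (frameCount F (ι ⊕ κ) * (r * Fintype.card V)) := by
      have e1 := mul_le_mul_of_nonneg_left hγ1 (by linarith : 0 ≤ (Fintype.card F : ℝ) ^ k)
      have e2 := mul_le_mul_of_nonneg_left hDr hγ.le
      linarith
    rw [← mul_div_assoc, le_div_iff₀ (by positivity)]
    have := mul_le_mul_of_nonneg_left h5 (mul_nonneg hε.le hg0)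
    linarith
  rw [hS2]
  refine hlow.trans (mul_le_mul_of_nonneg_left (split.trans (core.trans ?_)) (by norm_num))
  rw [hS2]
  gcongr

end Split

/-- The second moment bound is inconsistent with a deviation that is not tiny. -/
lemma lt_of_moment_parameters {q b S ε η A₁ A₂ W : ℝ} {C p : ℕ} (hp : p = C + 10) (hq : 2 ≤ q)
    (hb : 4 * (4096 * q ^ (4 * p)) ^ p ≤ b) (hS : 0 < S) (hS1 : S ≤ 1) (hbS : 1 ≤ b ^ 9 * S ^ 2)
    (hbε : 1 ≤ b ^ C * ε) (hη : η ≤ ε) (hA₁ : b ^ 10 ≤ A₁) (hA₂ : b ^ 6 ≤ A₂)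
    (hW0 : 0 ≤ W) (hW : W * b ^ 32 ≤ 4) :
    4 * (S ^ 2 / 16 * η + S ^ 2 / 16 * (2 ^ (2 * p) * ((S ^ 2 / A₁ + q ^ p * W) ^ p +
      (q ^ (2 * p) * (2 * S * b / A₂)) ^ (2 * p)) / (S ^ 2 / 16) ^ (2 * p)) +
      2 * S * b * ((S + q ^ (2 * p) * (1 / A₁)) ^ (2 * p) / (2 * S * b) ^ (2 * p))) <
      ε * S ^ 2 := by
  have hq1 : 1 ≤ q := by linarith
  have hqp : 1 ≤ q ^ p := one_le_pow₀ hq1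
  have hq2p : q ^ (2 * p) = (q ^ p) ^ 2 := by rw [mul_comm, pow_mul]
  have hq4p : q ^ (4 * p) = (q ^ p) ^ 4 := by rw [mul_comm, pow_mul]
  have hcb : 4096 * q ^ (4 * p) ≤ b := by
    have h1 : 1 ≤ 4096 * q ^ (4 * p) := by nlinarith [one_le_pow₀ (n := 4 * p) hq1]
    have := le_self_pow₀ h1 (by omega : p ≠ 0)
    linarith
  rw [hq4p] at hb hcb
  rw [hq2p]
  set u := q ^ p
  have hu2 : u ^ 2 ≤ u ^ 4 := pow_le_pow_right₀ hqp (by norm_num)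
  have hu1 : u ≤ u ^ 4 := le_self_pow₀ hqp (by norm_num)
  have hb1 : 4096 ≤ b := by nlinarith [one_le_pow₀ (n := 4) hqp]
  have hb0 : 0 < b := by linarith
  have hub : u ^ 2 ≤ b := by linarith [one_le_pow₀ (n := 4) hqp]
  have hub' : 4 * u ≤ b := by linarith [one_le_pow₀ (n := 4) hqp]
  have hA₁0 : 0 < A₁ := lt_of_lt_of_le (by positivity) hA₁
  have hA₂0 : 0 < A₂ := lt_of_lt_of_le (by positivity) hA₂
  have hε : 0 < ε := by
    by_contra! h
    nlinarith [pow_pos hb0 C]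
  have hS2 : S ^ 2 ≤ S := by nlinarith
  -- the last summand
  have hlast : 4 * (2 * S * b * ((S + u ^ 2 * (1 / A₁)) ^ (2 * p) / (2 * S * b) ^ (2 * p))) ≤
      ε * S ^ 2 / 8 := by
    have h1 : S + u ^ 2 * (1 / A₁) ≤ 2 * S := by
      have : u ^ 2 * (1 / A₁) ≤ S := by
        rw [mul_one_div, div_le_iff₀ hA₁0]
        calc u ^ 2 ≤ b * 1 := by linarith
          _ ≤ b * (b ^ 9 * S ^ 2) := by gcongr
          _ = S ^ 2 * b ^ 10 := by ring
          _ ≤ S * A₁ := by gcongr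
      linarith
    have h2 : (S + u ^ 2 * (1 / A₁)) ^ (2 * p) / (2 * S * b) ^ (2 * p) ≤ (1 / b) ^ (2 * p) := by
      rw [← div_pow]
      refine pow_le_pow_left₀ (by positivity) ?_ _
      rw [div_le_div_iff₀ (by positivity) hb0]
      nlinarith
    calc _ ≤ 4 * (2 * 1 * b * (1 / b) ^ (2 * p)) := by gcongr
      _ = 8 * (b / b ^ (2 * p)) := by rw [one_div, inv_pow]; ring
      _ ≤ 1 / (b ^ C * b ^ 9) / 8 := by
        rw [hp, ← mul_div_assoc, div_div, div_le_div_iff₀ (by positivity) (by positivity),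
          show 2 * (C + 10) = C + 9 + (C + 8) + 3 by ring, pow_add, pow_add, pow_add b C 9]
        have h3 : 1 ≤ b ^ (C + 8) := one_le_pow₀ (by linarith)
        have h4 : 0 < b ^ C * b ^ 9 := by positivity
        have h5 : 64 * b ≤ b ^ 3 := by nlinarith [mul_pos hb0 hb0]
        calc _ = (b ^ C * b ^ 9) * 1 * (64 * b) := by ring
          _ ≤ (b ^ C * b ^ 9) * b ^ (C + 8) * b ^ 3 := by gcongr
          _ = _ := by ring
      _ ≤ ε * S ^ 2 / 8 := by
        gcongr
        rw [div_le_iff₀ (by positivity)]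
        calc (1 : ℝ) = 1 * 1 := by ring
          _ ≤ (b ^ C * ε) * (b ^ 9 * S ^ 2) := by gcongr
          _ = _ := by ring
  have hmid : 4 * (S ^ 2 / 16 * (2 ^ (2 * p) * ((S ^ 2 / A₁ + u * W) ^ p +
      (u ^ 2 * (2 * S * b / A₂)) ^ (2 * p)) / (S ^ 2 / 16) ^ (2 * p))) ≤ ε * S ^ 2 / 8 := by
    have h1 : S ^ 2 / A₁ + u * W ≤ 2 * S ^ 2 / b ^ 10 := by
      have e1 : S ^ 2 / A₁ ≤ S ^ 2 / b ^ 10 := by gcongr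
      have e2 : u * W ≤ S ^ 2 / b ^ 10 := by
        rw [le_div_iff₀ (by positivity)]
        refine le_of_mul_le_mul_right ?_ (by positivity : 0 < b ^ 22)
        calc u * W * b ^ 10 * b ^ 22 = u * (W * b ^ 32) := by ring
          _ ≤ u * 4 := by gcongr
          _ ≤ b * 1 := by linarith
          _ ≤ b ^ 13 * (b ^ 9 * S ^ 2) := by
            gcongr
            exact le_self_pow₀ (by linarith) (by norm_num)
          _ = S ^ 2 * b ^ 22 := by ring
      calc _ ≤ S ^ 2 / b ^ 10 + S ^ 2 / b ^ 10 := add_le_add e1 e2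
        _ = _ := by ring
    have h2 : u ^ 2 * (2 * S * b / A₂) ≤ 2 * u ^ 2 * S / b ^ 5 := by
      calc _ ≤ u ^ 2 * (2 * S * b / b ^ 6) := by gcongr
        _ = _ := by field_simp
    have h3 : 4 * (S ^ 2 / A₁ + u * W) / (S ^ 2 / 16) ^ 2 ≤ 4096 * u ^ 4 / b := by
      calc _ ≤ 4 * (2 * S ^ 2 / b ^ 10) / (S ^ 2 / 16) ^ 2 := by gcongr
        _ = 2048 * 1 / (b * (b ^ 9 * S ^ 2)) := by field_simp; ring
        _ ≤ 4096 * u ^ 4 / (b * 1) := by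
          gcongr
          · norm_num
          · exact one_le_pow₀ hqp
        _ = _ := by rw [mul_one]
    have h4 : 4 * (u ^ 2 * (2 * S * b / A₂)) ^ 2 / (S ^ 2 / 16) ^ 2 ≤ 4096 * u ^ 4 / b := by
      calc _ ≤ 4 * (2 * u ^ 2 * S / b ^ 5) ^ 2 / (S ^ 2 / 16) ^ 2 := by gcongr
        _ = 4096 * u ^ 4 / (b * (b ^ 9 * S ^ 2)) := by field_simp; ring
        _ ≤ 4096 * u ^ 4 / (b * 1) := by gcongr
        _ = _ := by rw [mul_one]
    have h5 : 2 ^ (2 * p) * ((S ^ 2 / A₁ + u * W) ^ p +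
        (u ^ 2 * (2 * S * b / A₂)) ^ (2 * p)) / (S ^ 2 / 16) ^ (2 * p) ≤
        2 * (4096 * u ^ 4 / b) ^ p := by
      have e : 2 ^ (2 * p) * ((S ^ 2 / A₁ + u * W) ^ p +
        (u ^ 2 * (2 * S * b / A₂)) ^ (2 * p)) / (S ^ 2 / 16) ^ (2 * p) =
          (4 * (S ^ 2 / A₁ + u * W) / (S ^ 2 / 16) ^ 2) ^ p +
            (4 * (u ^ 2 * (2 * S * b / A₂)) ^ 2 / (S ^ 2 / 16) ^ 2) ^ p := by
        rw [div_pow _ _ p, div_pow _ _ p, mul_pow _ _ p, mul_pow _ _ p, pow_mul _ 2 p,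
          pow_mul _ 2 p, pow_mul _ 2 p]
        norm_num
        ring
      rw [e, two_mul ((_ : ℝ) ^ p)]
      exact add_le_add (pow_le_pow_left₀ (by positivity) h3 p)
        (pow_le_pow_left₀ (by positivity) h4 p)
    have h6 : (4096 * u ^ 4 / b) ^ p ≤ ε / 4 := by
      rw [div_pow, div_le_div_iff₀ (by positivity) (by norm_num)]
      calc _ = 4 * (4096 * u ^ 4) ^ p := by ring
        _ ≤ b * 1 := by linarith
        _ ≤ b ^ 10 * (b ^ C * ε) := by
          gcongr
          exact le_self_pow₀ (by linarith) (by norm_num)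
        _ = ε * b ^ p := by rw [hp]; ring
    calc _ ≤ 4 * (S ^ 2 / 16 * (2 * (ε / 4))) := by
          gcongr
          exact h5.trans (by gcongr)
      _ = _ := by ring
  have hfirst : 4 * (S ^ 2 / 16 * η) ≤ ε * S ^ 2 / 4 := by nlinarith [sq_nonneg S]
  nlinarith [mul_pos hε (pow_pos hS 2)]

section Assembly

variable {F : Type*} [Field F] {V : Type*} [AddCommGroup V] [Module F V] {k : ℕ}

open scoped Classical in
lemma zoomFrac_eq [Fintype (Submodule F V)] (Q W : Submodule F V) (𝓛 : Set (Submodule F V)) :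
    zoomFrac F V k Q W 𝓛 =
      ((Finset.univ.filter fun L : Submodule F V =>
        finrank F L = k ∧ Q ≤ L ∧ L ≤ W ∧ L ∈ 𝓛).card : ℝ) /
        (Finset.univ.filter fun L : Submodule F V => finrank F L = k ∧ Q ≤ L ∧ L ≤ W).card := by
  rw [zoomFrac, Nat.card_eq_fintype_card, Nat.card_eq_fintype_card, Fintype.card_subtype,
    Fintype.card_subtype]

open scoped Classical in
lemma grassFrac_eq [Fintype (Submodule F V)] (𝓛 : Set (Submodule F V)) :
    grassFrac F V k 𝓛 =
      ((Finset.univ.filter fun L : Submodule F V => finrank F L = k ∧ L ∈ 𝓛).card : ℝ) /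
        (Finset.univ.filter fun L : Submodule F V => finrank F L = k).card := by
  rw [grassFrac, Nat.card_eq_fintype_card, Nat.card_eq_fintype_card, Fintype.card_subtype,
    Fintype.card_subtype]

variable [Fintype F] [Fintype V] {η ε : ℝ}

open scoped Classical in
lemma sum_pointDeviation_sq_le [Fintype (Submodule F V)] {r D b : ℝ} {m C p : ℕ}
    (hm : 1 ≤ m) (hmk : 16 * m ≤ k) (hkn : k + 1 ≤ finrank F V)
    (𝓖 : Finset (Submodule F V)) (h𝓖 : ∀ L ∈ 𝓖, finrank F L = k)
    (hr : ∀ z : V, z ≠ 0 →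
      ((Finset.univ.filter fun L : Submodule F V => finrank F L = k ∧ z ∈ L).card : ℝ) = r)
    (hD : ((Finset.univ.filter fun L : Submodule F V => finrank F L = k).card : ℝ) = D)
    (hη : (𝓖.card : ℝ) = η * D) (hη0 : 0 < η) (hηε : η ≤ ε)
    (hpt : ∀ z : V, z ≠ 0 → pointDeviation 𝓖 r η z + η ≤ ε)
    (hker : ∀ α : Dual F V, α ≠ 0 → ((𝓖.filter (· ≤ LinearMap.ker α)).card : ℝ) ≤
      ε * (Finset.univ.filter fun L : Submodule F V =>
        finrank F L = k ∧ L ≤ LinearMap.ker α).card)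
    (hbm : b = (Fintype.card F : ℝ) ^ m) (hp : p = C + 10)
    (hb : 4 * (4096 * (Fintype.card F : ℝ) ^ (4 * p)) ^ p ≤ b) (hbε : 1 ≤ b ^ C * ε) :
    b ^ 9 * ∑ z, pointDeviation 𝓖 r η z ^ 2 ≤ Fintype.card V * ε ^ 2 := by
  have hF : (2 : ℝ) ≤ Fintype.card F := by exact_mod_cast Fintype.one_lt_card (α := F)
  obtain ⟨S, hS0, hS1, hsum, hS⟩ := exists_pointDeviation_bound (ι := Fin (10 * m))
    (κ := Fin (k - 10 * m)) (by simp; omega) (by omega) hkn 𝓖 h𝓖 hr hD hη hη0 hηε hpt hker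
  have hb0 : 0 < b := by rw [hbm]; positivity
  rw [hsum]
  by_contra! hlt
  have hV : (0 : ℝ) < Fintype.card V * ε ^ 2 := by
    have : 0 < ε := hη0.trans_le hηε
    have : (0 : ℝ) < Fintype.card V := by exact_mod_cast Fintype.card_pos
    positivity
  have hbS : 1 ≤ b ^ 9 * S ^ 2 := by
    refine le_of_mul_le_mul_left ?_ hV
    nlinarith
  have hSpos : 0 < S := by
    refine lt_of_le_of_ne hS0 fun h => ?_
    rw [← h] at hbS
    norm_num at hbS
  have h := hS (2 * S * b) (S ^ 2 / 16) (by positivity) (by positivity) p (by omega)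
  refine absurd h (not_le.2 (lt_of_moment_parameters hp hF hb hSpos hS1 hbS hbε hηε ?_ ?_
    (by positivity) ?_))
  · rw [Fintype.card_fin, hbm, ← pow_mul, mul_comm m]
  · rw [Fintype.card_fin, hbm, ← pow_mul]
    exact pow_le_pow_right₀ (by linarith) (by omega)
  · rw [hbm, div_pow, ← pow_mul, ← pow_mul, div_mul_eq_mul_div, div_le_iff₀ (by positivity)]
    norm_num
    exact pow_le_pow_right₀ (by linarith) (by omega)

open scoped Classical in
/-- For a pseudo-random family, few points have an atypical local density. -/
lemma card_atypical_le {m C p : ℕ} {b : ℝ} (hm : 1 ≤ m) (hmk : 16 * m ≤ k)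
    (hkn : k + 1 ≤ finrank F V) (𝓛 : Set (Submodule F V)) (hη : η = grassFrac F V k 𝓛)
    (hη0 : 0 < η) (hηε : η ≤ ε) (h𝓛 : PseudoRandom F V k 1 ε 𝓛)
    (hbm : b = (Fintype.card F : ℝ) ^ m) (hp : p = C + 10)
    (hb : 4 * (4096 * (Fintype.card F : ℝ) ^ (4 * p)) ^ p ≤ b) (hbε : 1 ≤ b ^ C * ε) :
    b ^ 9 * η ^ 2 * (((Finset.univ.filter fun z : V =>
      ¬ |zoomFrac F V k (Submodule.span F {z}) ⊤ 𝓛 - η| ≤ η / 10).card : ℝ) - 1) ≤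
      100 * (Fintype.card V * ε ^ 2) := by
  have : Fintype (Submodule F V) := Fintype.ofFinite _
  have hnt : Nontrivial V := Module.nontrivial_of_finrank_pos (R := F) (by omega)
  obtain ⟨z₀, hz₀⟩ := exists_ne (0 : V)
  set r : ℝ :=
    ((Finset.univ.filter fun L : Submodule F V => finrank F L = k ∧ z₀ ∈ L).card : ℝ)
  set D : ℝ := ((Finset.univ.filter fun L : Submodule F V => finrank F L = k).card : ℝ) with hD
  set 𝓖 := Finset.univ.filter fun L : Submodule F V => finrank F L = k ∧ L ∈ 𝓛 with h𝓖
  have hr : ∀ z : V, z ≠ 0 →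
      ((Finset.univ.filter fun L : Submodule F V => finrank F L = k ∧ z ∈ L).card : ℝ) = r :=
    fun z hz => by rw [card_mem_eq k hz hz₀]
  have hηD : (𝓖.card : ℝ) = η * D := by
    rw [grassFrac_eq] at hη
    rw [hη, div_mul_cancel₀]
    intro h0
    rw [h0, div_zero] at hη
    exact hη0.ne' hη
  have hzoom : ∀ z : V, z ≠ 0 →
      zoomFrac F V k (Submodule.span F {z}) ⊤ 𝓛 = pointDeviation 𝓖 r η z + η := by
    intro z hz
    rw [zoomFrac_eq, pointDeviation, if_neg hz, sub_add_cancel, ← hr z hz, h𝓖,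
      Finset.filter_filter]
    simp only [Submodule.span_singleton_le_iff_mem, le_top, true_and, and_true]
    congr 3
    ext L
    simp only [Finset.mem_filter]
    tauto
  have hbound := sum_pointDeviation_sq_le hm hmk hkn 𝓖 (fun L hL => (Finset.mem_filter.1 hL).2.1)
    hr hD.symm hηD hη0 hηε (fun z hz => ?_) (fun α hα => ?_) hbm hp hb hbε
  · have hF : (0 : ℝ) < Fintype.card F := by exact_mod_cast Fintype.card_pos
    have hb0 : 0 < b := by rw [hbm]; positivity
    set B := Finset.univ.filter fun z : V =>
      ¬ |zoomFrac F V k (Submodule.span F {z}) ⊤ 𝓛 - η| ≤ η / 10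
    have h1 : ((B.erase 0).card : ℝ) * (η / 10) ^ 2 ≤ ∑ z, pointDeviation 𝓖 r η z ^ 2 := by
      rw [← nsmul_eq_mul]
      refine (Finset.card_nsmul_le_sum (B.erase 0) (fun z => pointDeviation 𝓖 r η z ^ 2) _
        fun z hz => ?_).trans (Finset.sum_le_univ_sum_of_nonneg fun z => sq_nonneg _)
      have hz' := Finset.mem_erase.1 hz
      have := (Finset.mem_filter.1 hz'.2).2
      rw [hzoom z hz'.1, add_sub_cancel_right, not_le] at this
      rw [← sq_abs (pointDeviation _ _ _ _)]
      gcongr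
    have h2 : (B.card : ℝ) - 1 ≤ (B.erase 0).card := by
      have := Finset.pred_card_le_card_erase (s := B) (a := 0)
      rw [sub_le_iff_le_add]
      exact_mod_cast (by omega : B.card ≤ (B.erase 0).card + 1)
    calc b ^ 9 * η ^ 2 * ((B.card : ℝ) - 1) ≤ b ^ 9 * η ^ 2 * (B.erase 0).card := by gcongr
      _ = 100 * (b ^ 9 * ((B.erase 0).card * (η / 10) ^ 2)) := by ring
      _ ≤ 100 * (b ^ 9 * ∑ z, pointDeviation 𝓖 r η z ^ 2) := by gcongr
      _ ≤ _ := by gcongr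
  · rw [← hzoom z hz]
    exact h𝓛 _ _ le_top (by rw [finrank_span_singleton hz, finrank_top]; omega)
  · have h := h𝓛 ⊥ (LinearMap.ker α) bot_le (by
      have := Module.Dual.finrank_ker_add_one_of_ne_zero hα
      rw [finrank_bot]
      omega)
    simp only [zoomFrac_eq, bot_le, true_and] at h
    have hfilter : 𝓖.filter (· ≤ LinearMap.ker α) = Finset.univ.filter fun L : Submodule F V =>
        finrank F L = k ∧ L ≤ LinearMap.ker α ∧ L ∈ 𝓛 := by
      ext L
      simp only [h𝓖, Finset.mem_filter]
      tauto
    rw [hfilter]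
    rcases Nat.eq_zero_or_pos (Finset.univ.filter fun L : Submodule F V =>
      finrank F L = k ∧ L ≤ LinearMap.ker α).card with h0 | h0
    · have hle : (Finset.univ.filter fun L : Submodule F V =>
          finrank F L = k ∧ L ≤ LinearMap.ker α ∧ L ∈ 𝓛).card ≤ 0 := by
        rw [← h0]
        exact Finset.card_le_card (Finset.monotone_filter_right _ fun L _ hL => ⟨hL.1, hL.2.1⟩)
      rw [h0, Nat.le_zero.1 hle]
      simp
    · exact (div_le_iff₀ (by exact_mod_cast h0)).1 h

end Assembly

lemma exists_forall_le_pow (q T : ℝ) (hq : 2 ≤ q) : ∃ m₀ : ℕ, ∀ m, m₀ ≤ m → T ≤ q ^ m := by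
  have := (tendsto_pow_atTop_atTop_of_one_lt (by linarith : 1 < q)).eventually_ge_atTop T
  exact Filter.eventually_atTop.1 this

/-- even covering of points by a pseudo-random family, Lemma 2.6.
For every finite field `F` of order `q` and every `ξ > 0`, for all sufficiently large `ℓ`,
every `ℓ' ≥ (ξ/3)ℓ`, every space `V` of dimension at least `ℓ'²` and every
`𝓛 ⊆ Grass(V, ℓ')` of measure `η ≥ q^(-2ℓ)` that is `(1, q^(δ₂ℓ/100)·η)`-pseudo-random
with `δ₂ = ξ/100`, the set `Z = {z ∈ V : |μ_{span z}(𝓛) - η| ≤ η/10}` has size at least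
`(1 - q^(-ℓ'/2))·|V|`. -/
theorem stmt1 (F : Type) [Field F] [Fintype F] (ξ : ℝ) (hξ : 0 < ξ) :
    ∃ ℓ₀ : ℕ, ∀ ℓ : ℕ, ℓ₀ ≤ ℓ →
      ∀ ℓ' : ℕ, (ξ / 3) * ℓ ≤ (ℓ' : ℝ) →
      ∀ (V : Type) [AddCommGroup V] [Module F V] [FiniteDimensional F V],
        ℓ' ^ 2 ≤ finrank F V →
      ∀ (𝓛 : Set (Submodule F V)) (η : ℝ),
        η = grassFrac F V ℓ' 𝓛 →
        (Fintype.card F : ℝ) ^ (-(2 * (ℓ : ℝ))) ≤ η →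
        PseudoRandom F V ℓ' 1 ((Fintype.card F : ℝ) ^ ((ξ / 100) * ℓ / 100) * η) 𝓛 →
        (1 - (Fintype.card F : ℝ) ^ (-((ℓ' : ℝ) / 2))) * (Nat.card V : ℝ) ≤
          (Nat.card {z : V //
            |zoomFrac F V ℓ' (Submodule.span F {z}) ⊤ 𝓛 - η| ≤ η / 10} : ℝ) := by
  have hF : (2 : ℝ) ≤ Fintype.card F := by exact_mod_cast Fintype.one_lt_card (α := F)
  set q : ℝ := (Fintype.card F : ℝ) with hq
  have hq0 : 0 < q := by linarith
  have hq1 : 1 ≤ q := by linarith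
  set C : ℕ := ⌈186 / ξ⌉₊
  obtain ⟨m₀, hm₀⟩ := exists_forall_le_pow q (4 * (4096 * q ^ (4 * (C + 10))) ^ (C + 10)) hF
  refine ⟨⌈3 / ξ * (16 * (m₀ + 20) : ℕ)⌉₊, fun ℓ hℓ k hk V _ _ _ hkn 𝓛 η hη hηq h𝓛 => ?_⟩
  classical
  have : Finite V := Module.finite_of_finite F
  have : Fintype V := Fintype.ofFinite V
  have hℓk : 16 * (m₀ + 20) ≤ k := by
    have h1 := Nat.ceil_le.1 hℓ
    have h2 : ((16 * (m₀ + 20) : ℕ) : ℝ) ≤ k := by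
      refine le_trans ?_ hk
      rw [div_mul_eq_mul_div, div_le_iff₀ hξ] at h1
      linarith
    exact_mod_cast h2
  set m := k / 16 with hm
  have hmk : 16 * m ≤ k := by omega
  have hmk' : k ≤ 16 * m + 15 := by omega
  have hmm : m₀ + 20 ≤ m := by omega
  have hkR : (k : ℝ) ≤ 16 * m + 15 := by exact_mod_cast hmk'
  have hmR : (20 : ℝ) ≤ m := by exact_mod_cast (by omega : 20 ≤ m)
  have hkn' : k + 1 ≤ finrank F V := by nlinarith
  have hη0 : 0 < η := lt_of_lt_of_le (Real.rpow_pos_of_pos hq0 _) hηq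
  have hηε : η ≤ q ^ ((ξ / 100) * ℓ / 100) * η :=
    le_mul_of_one_le_left hη0.le (Real.one_le_rpow hq1 (by positivity))
  have hbη : 1 ≤ (q ^ m) ^ C * η := by
    have hexp : 2 * (ℓ : ℝ) ≤ (m * C : ℕ) := by
      have h1 : 186 / ξ ≤ C := Nat.le_ceil _
      rw [div_le_iff₀ hξ] at h1
      push_cast
      have h2 : (m : ℝ) * 186 ≤ m * (C * ξ) := by gcongr
      refine le_of_mul_le_mul_right ?_ hξ
      nlinarith
    calc (1 : ℝ) = q ^ (2 * (ℓ : ℝ)) * q ^ (-(2 * (ℓ : ℝ))) := by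
          rw [← Real.rpow_add hq0]; simp
      _ ≤ q ^ ((m * C : ℕ) : ℝ) * η := by
          gcongr
      _ = _ := by rw [Real.rpow_natCast, pow_mul]
  have hcard := card_atypical_le (C := C) (p := C + 10) (b := q ^ m) (by omega) hmk hkn' 𝓛 hη hη0
    hηε h𝓛 rfl rfl (hm₀ m (by omega)) (hbη.trans (by gcongr))
  set B := Finset.univ.filter fun z : V =>
    ¬ |zoomFrac F V k (Submodule.span F {z}) ⊤ 𝓛 - η| ≤ η / 10
  have hcompl : (Nat.card {z : V //
      |zoomFrac F V k (Submodule.span F {z}) ⊤ 𝓛 - η| ≤ η / 10} : ℝ) = Fintype.card V - B.card := by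
    rw [Nat.card_eq_fintype_card, Fintype.card_subtype, eq_sub_iff_add_eq]
    exact_mod_cast Finset.card_filter_add_card_filter_not _
  rw [hcompl, Nat.card_eq_fintype_card]
  have hVq : (Fintype.card V : ℝ) = q ^ finrank F V := by
    rw [hq, ← Nat.cast_pow, Module.card_eq_pow_finrank (K := F) (V := V)]
  set x := q ^ ((ξ / 100) * ℓ / 100)
  have hx0 : 0 < x := Real.rpow_pos_of_pos hq0 _
  have hone : 2 * 1 ≤ q ^ (-((k : ℝ) / 2)) * Fintype.card V := by
    rw [hVq, ← Real.rpow_natCast, ← Real.rpow_add hq0]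
    have h1 : (k : ℝ) + 1 ≤ finrank F V := by exact_mod_cast hkn'
    calc (2 * 1 : ℝ) ≤ q ^ (1 : ℝ) := by rw [Real.rpow_one]; linarith
      _ ≤ _ := Real.rpow_le_rpow_of_exponent_le hq1 (by linarith)
  have hmain : 200 * x ^ 2 ≤ q ^ (-((k : ℝ) / 2)) * (q ^ m) ^ 9 := by
    have h200 : (200 : ℝ) ≤ q ^ (8 : ℝ) := by
      calc (200 : ℝ) ≤ 2 ^ 8 := by norm_num
        _ ≤ q ^ 8 := by gcongr
        _ = _ := by norm_cast
    calc 200 * x ^ 2 ≤ q ^ (8 : ℝ) * x ^ 2 := by gcongr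
      _ = q ^ (8 + (ξ / 100) * ℓ / 100 * 2) := by
        rw [Real.rpow_add hq0, Real.rpow_mul hq0.le _ 2]
        norm_cast
      _ ≤ q ^ (-((k : ℝ) / 2) + (m * 9 : ℕ)) := by
        refine Real.rpow_le_rpow_of_exponent_le hq1 ?_
        push_cast
        nlinarith
      _ = _ := by rw [Real.rpow_add hq0, Real.rpow_natCast, pow_mul]
  have hB : (B.card : ℝ) - 1 ≤ q ^ (-((k : ℝ) / 2)) * Fintype.card V / 2 := by
    refine le_of_mul_le_mul_left (hcard.trans ?_)
      (by positivity : 0 < (q ^ m) ^ 9 * η ^ 2)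
    have := mul_le_mul_of_nonneg_left hmain (by positivity : 0 ≤ Fintype.card V * η ^ 2)
    linarith
  linarith
end

section
/- Let F be a field and V an F-vector space, and let L₁, L₂, L₃, H₁, H₂, H₃ be F-linear subspaces of V satisfying L₁ + H₁ + H₂ = L₂ + H₁ + H₂ and L₂ + H₂ + H₃ = L₃ + H₂ + H₃. Suppose moreover that H₂ = A + B for subspaces A, B of V with A ⊆ H₁ + H₃ and B ∩ (L₁ + L₃ + H₁ + H₃) = {0}. Then L₁ + H₁ + H₃ = L₃ + H₁ + H₃. -/
/-- In a modular lattice, two elements with the same join with `b` agree as soon as `b` is disjoint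
from their join. -/
theorem eq_of_sup_eq_sup_of_inf_sup_eq_bot {α : Type*} [Lattice α] [OrderBot α]
    [IsModularLattice α] {x y b : α} (hsup : x ⊔ b = y ⊔ b) (hinf : b ⊓ (x ⊔ y) = ⊥) : x = y := by
  have hx : (x ⊔ b) ⊓ (x ⊔ y) = x := by
    rw [sup_inf_assoc_of_le b le_sup_left, hinf, sup_bot_eq]
  have hy : (y ⊔ b) ⊓ (x ⊔ y) = y := by
    rw [sup_inf_assoc_of_le b le_sup_right, hinf, sup_bot_eq]
  rw [← hx, hsup, hy]

/-- transitivity of the clique relation, Lemma 4.1.  If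
`L₁ + H₁ + H₂ = L₂ + H₁ + H₂` and `L₂ + H₂ + H₃ = L₃ + H₂ + H₃`, and moreover
`H₂ = A + B` with `A ⊆ H₁ + H₃` and `B ∩ (L₁ + L₃ + H₁ + H₃) = {0}`, then
`L₁ + H₁ + H₃ = L₃ + H₁ + H₃`. -/
theorem stmt2 (F V : Type*) [Field F] [AddCommGroup V] [Module F V]
    (L₁ L₂ L₃ H₁ H₂ H₃ A B : Submodule F V)
    (h12 : L₁ ⊔ H₁ ⊔ H₂ = L₂ ⊔ H₁ ⊔ H₂)
    (h23 : L₂ ⊔ H₂ ⊔ H₃ = L₃ ⊔ H₂ ⊔ H₃)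
    (hH2 : H₂ = A ⊔ B)
    (hA : A ≤ H₁ ⊔ H₃)
    (hB : B ⊓ (L₁ ⊔ L₃ ⊔ H₁ ⊔ H₃) = ⊥) :
    L₁ ⊔ H₁ ⊔ H₃ = L₃ ⊔ H₁ ⊔ H₃ := by
  have hsup (L : Submodule F V) : L ⊔ H₁ ⊔ H₃ ⊔ B = L ⊔ H₁ ⊔ H₂ ⊔ H₃ := by
    have hAW : H₁ ⊔ H₃ ⊔ A = H₁ ⊔ H₃ := sup_eq_left.mpr hA
    calc L ⊔ H₁ ⊔ H₃ ⊔ B = L ⊔ (H₁ ⊔ H₃) ⊔ B := by ac_rfl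
      _ = L ⊔ (H₁ ⊔ H₃ ⊔ A) ⊔ B := by rw [hAW]
      _ = L ⊔ H₁ ⊔ H₂ ⊔ H₃ := by rw [hH2]; ac_rfl
  apply eq_of_sup_eq_sup_of_inf_sup_eq_bot (b := B)
  · calc L₁ ⊔ H₁ ⊔ H₃ ⊔ B = L₂ ⊔ H₁ ⊔ H₂ ⊔ H₃ := by rw [hsup, h12]
      _ = L₂ ⊔ H₂ ⊔ H₃ ⊔ H₁ := by ac_rfl
      _ = L₃ ⊔ H₂ ⊔ H₃ ⊔ H₁ := by rw [h23]
      _ = L₃ ⊔ H₁ ⊔ H₂ ⊔ H₃ := by ac_rfl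
      _ = L₃ ⊔ H₁ ⊔ H₃ ⊔ B := (hsup L₃).symm
  · rw [← hB]
    congr 1
    ac_rfl
end
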